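/- arXiv:1104.3131 — 2 statements merged into one kernel-verified Lean document; each statement's English description precedes it below -/
import Mathlib

section
/- Under the stated setting, assume conditions (3.3), (3.4), (3.5) hold for constants M, R, K, ω, δ > 0, and let k : ℝⁿ → ℝ be any locally bounded function with k(0) = 0. Then there exist r̃ > 0 and a continuous function T : ℝ → [0,∞) such that: for every sampling schedule with MASP r̃, every measurable d : [0,∞) → D, and every solution (x,y) of the closed-loop system (3.7) with x(0)'Px(0) < R², the function z(t) := y(t) + c'x(t) satisfies |z(t)| ≤ max(|z(0)|, ω⁻¹) for all t ≥ 0, and |z(t)| ≤ ω⁻¹ for all t ≥ T(z(0)). -/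
open Matrix MeasureTheory Set Filter

noncomputable section

/-- The `m × m` matrix with ones on the subdiagonal and zeros elsewhere. -/
def matA (m : ℕ) : Matrix (Fin m) (Fin m) ℝ :=
  Matrix.of fun i j => if (i : ℕ) = (j : ℕ) + 1 then 1 else 0

/-- The vector `b = (1,0,…,0)'` as a plain function. -/
def vecbf (m : ℕ) : Fin m → ℝ := fun i => if (i : ℕ) = 0 then 1 else 0

/-- The vector `b = (1,0,…,0)'` in Euclidean space. -/
def vecb (m : ℕ) : EuclideanSpace ℝ (Fin m) := (WithLp.equiv 2 (Fin m → ℝ)).symm (vecbf m)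

/-- View a Euclidean vector as a plain function. -/
def ef {m : ℕ} (x : EuclideanSpace ℝ (Fin m)) : Fin m → ℝ := x

/-- Matrix-vector multiplication on Euclidean space. -/
def mulVecE {m : ℕ} (M : Matrix (Fin m) (Fin m) ℝ) (x : EuclideanSpace ℝ (Fin m)) :
    EuclideanSpace ℝ (Fin m) :=
  (WithLp.equiv 2 (Fin m → ℝ)).symm (M.mulVec (ef x))

/-- Euclidean inner product `x'y`. -/
def ip {m : ℕ} (x y : EuclideanSpace ℝ (Fin m)) : ℝ := ∑ i, x i * y i

/-- Quadratic form `x'Px`. -/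
def qf {m : ℕ} (P : Matrix (Fin m) (Fin m) ℝ) (x : EuclideanSpace ℝ (Fin m)) : ℝ :=
  ip x (mulVecE P x)

/-- The saturation function `sat(s) = s / max(1,|s|)`. -/
def sat (s : ℝ) : ℝ := s / max 1 |s|

/-- The vector `c = -(A' + pb')⁻¹ (0,…,0,1)'`. -/
def cvec (n : ℕ) (p : EuclideanSpace ℝ (Fin (n+1))) : EuclideanSpace ℝ (Fin (n+1)) :=
  (WithLp.equiv 2 (Fin (n+1) → ℝ)).symm
    (-((((matA (n+1))ᵀ + vecMulVec (ef p) (vecbf (n+1)))⁻¹).mulVec (Pi.single (Fin.last n) 1)))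

/-- Condition (3.3): `x'P(Ax + f(d,x,u) + bu) < 0` whenever `d ∈ D`, `x'Px = R²` and
`|u - p'x| ≤ K|c'b|`. -/
def Cond33 {l n : ℕ} (D : Set (EuclideanSpace ℝ (Fin l)))
    (f : EuclideanSpace ℝ (Fin l) → EuclideanSpace ℝ (Fin (n+1)) → ℝ → EuclideanSpace ℝ (Fin (n+1)))
    (P : Matrix (Fin (n+1)) (Fin (n+1)) ℝ) (p : EuclideanSpace ℝ (Fin (n+1))) (R K : ℝ) : Prop :=
  ∀ d ∈ D, ∀ x : EuclideanSpace ℝ (Fin (n+1)), ∀ u : ℝ,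
    qf P x = R ^ 2 → |u - ip p x| ≤ K * |ip (cvec n p) (vecb (n+1))| →
      ip x (mulVecE P (mulVecE (matA (n+1)) x + f d x u + u • vecb (n+1))) < 0

/-- Condition (3.4): `|g(d,x,u) + c'f(d,x,u)| < K(c'b)²` whenever `d ∈ D`, `x'Px ≤ R²` and
`|u - p'x| ≤ K|c'b|`. -/
def Cond34 {l n : ℕ} (D : Set (EuclideanSpace ℝ (Fin l)))
    (f : EuclideanSpace ℝ (Fin l) → EuclideanSpace ℝ (Fin (n+1)) → ℝ → EuclideanSpace ℝ (Fin (n+1)))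
    (g : EuclideanSpace ℝ (Fin l) → EuclideanSpace ℝ (Fin (n+1)) → ℝ → ℝ)
    (P : Matrix (Fin (n+1)) (Fin (n+1)) ℝ) (p : EuclideanSpace ℝ (Fin (n+1))) (R K : ℝ) : Prop :=
  ∀ d ∈ D, ∀ x : EuclideanSpace ℝ (Fin (n+1)), ∀ u : ℝ,
    qf P x ≤ R ^ 2 → |u - ip p x| ≤ K * |ip (cvec n p) (vecb (n+1))| →
      |g d x u + ip (cvec n p) (f d x u)| < K * (ip (cvec n p) (vecb (n+1))) ^ 2

/-- Condition (3.5). -/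
def Cond35 {l n : ℕ} (D : Set (EuclideanSpace ℝ (Fin l)))
    (f : EuclideanSpace ℝ (Fin l) → EuclideanSpace ℝ (Fin (n+1)) → ℝ → EuclideanSpace ℝ (Fin (n+1)))
    (g : EuclideanSpace ℝ (Fin l) → EuclideanSpace ℝ (Fin (n+1)) → ℝ → ℝ)
    (P : Matrix (Fin (n+1)) (Fin (n+1)) ℝ) (p : EuclideanSpace ℝ (Fin (n+1)))
    (M R K ω δ : ℝ) : Prop :=
  ∀ d ∈ D, ∀ x : EuclideanSpace ℝ (Fin (n+1)), ∀ z : ℝ,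
    qf P x ≤ R ^ 2 → ω * |z| ≤ 1 →
      ∀ u : ℝ, u = ip p x - K * ip (cvec n p) (vecb (n+1)) * ω * z →
        z * (M * g d x u + M * ip (cvec n p) (f d x u)
              - K * ip (cvec n p) (vecb (n+1)) * ω * ip (vecb (n+1)) (mulVecE P x))
          ≤ (M * K * (ip (cvec n p) (vecb (n+1))) ^ 2 * ω - δ) * z ^ 2
            - ip x (mulVecE P
                (mulVecE (matA (n+1) + vecMulVec (vecbf (n+1)) (ef p) + δ • 1) x + f d x u))

/-- A sampling schedule with maximum allowable sampling period `r`. -/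
def Sched (r : ℝ) (τ : ℕ → ℝ) : Prop :=
  τ 0 = 0 ∧ (∀ i, 0 < τ (i+1) - τ i) ∧ (∀ i, τ (i+1) - τ i ≤ r) ∧
    Tendsto τ atTop atTop

open Classical in
/-- The hybrid feedback `k̃` of (3.6). -/
def ktilde {n : ℕ} (k : EuclideanSpace ℝ (Fin (n+1)) → ℝ)
    (P : Matrix (Fin (n+1)) (Fin (n+1)) ℝ) (p : EuclideanSpace ℝ (Fin (n+1)))
    (R K ω : ℝ) (x : EuclideanSpace ℝ (Fin (n+1))) (y : ℝ) : ℝ :=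
  if R ^ 2 ≤ qf P x then k x
  else ip p x - K * ip (cvec n p) (vecb (n+1)) * sat (ω * (y + ip (cvec n p) x))

/-- A (locally absolutely continuous) solution of the closed-loop sampled-data system (3.7)
with feedback `fb`, sampling times `τ` and disturbance `d`. -/
def Sol37 {l n : ℕ}
    (f : EuclideanSpace ℝ (Fin l) → EuclideanSpace ℝ (Fin (n+1)) → ℝ → EuclideanSpace ℝ (Fin (n+1)))
    (g : EuclideanSpace ℝ (Fin l) → EuclideanSpace ℝ (Fin (n+1)) → ℝ → ℝ)
    (fb : EuclideanSpace ℝ (Fin (n+1)) → ℝ → ℝ) (τ : ℕ → ℝ)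
    (d : ℝ → EuclideanSpace ℝ (Fin l))
    (x : ℝ → EuclideanSpace ℝ (Fin (n+1))) (y : ℝ → ℝ) : Prop :=
  ∃ (x' : ℝ → EuclideanSpace ℝ (Fin (n+1))) (y' : ℝ → ℝ),
    (∀ T : ℝ, IntervalIntegrable x' volume 0 T) ∧
    (∀ T : ℝ, IntervalIntegrable y' volume 0 T) ∧
    (∀ t : ℝ, 0 ≤ t → x t = x 0 + ∫ s in (0:ℝ)..t, x' s) ∧
    (∀ t : ℝ, 0 ≤ t → y t = y 0 + ∫ s in (0:ℝ)..t, y' s) ∧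
    ∀ i : ℕ, ∀ᵐ t ∂(volume.restrict (Ico (τ i) (τ (i+1)))),
      x' t = mulVecE (matA (n+1)) (x t) + f (d t) (x t) (fb (x (τ i)) (y (τ i)))
          + fb (x (τ i)) (y (τ i)) • vecb (n+1) ∧
      y' t = x t (Fin.last n) + g (d t) (x t) (fb (x (τ i)) (y (τ i)))

theorem ip_eq_inner {m : ℕ} (x y : EuclideanSpace ℝ (Fin m)) : ip x y = inner ℝ x y := by
  simp [ip, PiLp.inner_apply, mul_comm]

theorem ip_eq_dotProduct {m : ℕ} (x y : EuclideanSpace ℝ (Fin m)) : ip x y = ef x ⬝ᵥ ef y := rfl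

theorem ef_mulVecE {m : ℕ} (P : Matrix (Fin m) (Fin m) ℝ) (x : EuclideanSpace ℝ (Fin m)) :
    ef (mulVecE P x) = P *ᵥ ef x := rfl

theorem mulVecE_eq_toEuclideanCLM {m : ℕ} (P : Matrix (Fin m) (Fin m) ℝ)
    (x : EuclideanSpace ℝ (Fin m)) :
    mulVecE P x = Matrix.toEuclideanCLM (n := Fin m) (𝕜 := ℝ) P x := rfl

theorem Continuous.ip {X : Type*} [TopologicalSpace X] {m : ℕ}
    {a b : X → EuclideanSpace ℝ (Fin m)} (ha : Continuous a) (hb : Continuous b) :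
    Continuous fun t => ip (a t) (b t) := by
  simp only [ip_eq_inner]
  exact ha.inner hb

theorem Continuous.mulVecE {X : Type*} [TopologicalSpace X] {m : ℕ}
    (P : Matrix (Fin m) (Fin m) ℝ) {a : X → EuclideanSpace ℝ (Fin m)} (ha : Continuous a) :
    Continuous fun t => mulVecE P (a t) := by
  simp only [mulVecE_eq_toEuclideanCLM]
  exact (Matrix.toEuclideanCLM (n := Fin m) (𝕜 := ℝ) P).continuous.comp ha

theorem Continuous.qf {X : Type*} [TopologicalSpace X] {m : ℕ}
    (P : Matrix (Fin m) (Fin m) ℝ) {a : X → EuclideanSpace ℝ (Fin m)} (ha : Continuous a) :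
    Continuous fun t => qf P (a t) :=
  ha.ip (ha.mulVecE P)

theorem ip_mulVecE {m : ℕ} (P : Matrix (Fin m) (Fin m) ℝ) (x y : EuclideanSpace ℝ (Fin m)) :
    ip x (mulVecE P y) = ip (mulVecE Pᵀ x) y := by
  simp only [ip_eq_dotProduct, ef_mulVecE, Matrix.dotProduct_mulVec, Matrix.mulVec_transpose]

theorem qf_pos {m : ℕ} {P : Matrix (Fin m) (Fin m) ℝ} (hP : P.PosDef)
    {x : EuclideanSpace ℝ (Fin m)} (hx : x ≠ 0) : 0 < qf P x := by
  have h := hP.dotProduct_mulVec_pos (x := ef x) (fun h => hx (by ext i; exact congrFun h i))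
  simpa [qf, ip_eq_dotProduct, ef_mulVecE] using h

theorem qf_smul {m : ℕ} (P : Matrix (Fin m) (Fin m) ℝ) (a : ℝ) (x : EuclideanSpace ℝ (Fin m)) :
    qf P (a • x) = a ^ 2 * qf P x := by
  simp only [qf, mulVecE_eq_toEuclideanCLM, ip_eq_inner, map_smul, inner_smul_left,
    inner_smul_right, conj_trivial]
  ring

/-- A quadratic form of a symmetric matrix lies above its tangent planes. -/
theorem qf_add_two_mul_ip_le {m : ℕ} {P : Matrix (Fin m) (Fin m) ℝ} (hP : P.PosDef)
    (w x : EuclideanSpace ℝ (Fin m)) :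
    qf P w + 2 * (ip w (mulVecE P x) - ip w (mulVecE P w)) ≤ qf P x := by
  have hsymm : Pᵀ = P := hP.isHermitian
  have h0 : 0 ≤ qf P (x - w) := by
    rcases eq_or_ne (x - w) 0 with h | h
    · simp [h, qf, ip]
    · exact (qf_pos hP h).le
  have hcomm : ip x (mulVecE P w) = ip w (mulVecE P x) := by
    rw [ip_mulVecE, hsymm, ip_eq_inner, ip_eq_inner, real_inner_comm]
  have hexp : qf P (x - w) =
      qf P x - ip x (mulVecE P w) - ip w (mulVecE P x) + ip w (mulVecE P w) := by
    simp only [qf, mulVecE_eq_toEuclideanCLM, ip_eq_inner, map_sub, inner_sub_left,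
      inner_sub_right]
    ring
  have : qf P w = ip w (mulVecE P w) := rfl
  linarith

theorem isCompact_setOf_qf_le {m : ℕ} {P : Matrix (Fin m) (Fin m) ℝ} (hP : P.PosDef) (ρ : ℝ) :
    IsCompact {x : EuclideanSpace ℝ (Fin m) | qf P x ≤ ρ} := by
  obtain ⟨a, ha, hle⟩ := (isCompact_sphere (0 : EuclideanSpace ℝ (Fin m)) 1).exists_forall_le'
    (f := qf P) (a := 0) (Continuous.qf P continuous_id).continuousOn
    (fun x hx => qf_pos hP (by rintro rfl; simp at hx))
  have hcoer : ∀ x : EuclideanSpace ℝ (Fin m), a * ‖x‖ ^ 2 ≤ qf P x := by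
    intro x
    rcases eq_or_ne x 0 with rfl | hx
    · simp [qf, ip]
    · have hn : 0 < ‖x‖ := norm_pos_iff.2 hx
      have h := hle (‖x‖⁻¹ • x) (by simp [norm_smul, hn.ne'])
      rw [qf_smul] at h
      calc a * ‖x‖ ^ 2 ≤ ‖x‖⁻¹ ^ 2 * qf P x * ‖x‖ ^ 2 := by gcongr
        _ = qf P x := by field_simp
  refine Metric.isCompact_of_isClosed_isBounded
    (isClosed_le (Continuous.qf P continuous_id) continuous_const) ?_
  refine (Metric.isBounded_closedBall (x := (0 : EuclideanSpace ℝ (Fin m)))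
    (r := 1 + ρ / a)).subset fun x hx => ?_
  have h1 : a * ‖x‖ ^ 2 ≤ ρ := (hcoer x).trans hx
  have h2 : ‖x‖ ^ 2 ≤ ρ / a := by rw [le_div_iff₀ ha]; linarith
  simp only [mem_closedBall_zero_iff]
  nlinarith [sq_nonneg (‖x‖ - 1), norm_nonneg x]

theorem ip_cvec_mulVecE {n : ℕ} {P : Matrix (Fin (n+1)) (Fin (n+1)) ℝ}
    {p : EuclideanSpace ℝ (Fin (n+1))}
    (hneg : (-(P * (matA (n+1) + vecMulVec (vecbf (n+1)) (ef p))
        + ((matA (n+1))ᵀ + vecMulVec (ef p) (vecbf (n+1))) * P)).PosDef)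
    (x : EuclideanSpace ℝ (Fin (n+1))) (u : ℝ) :
    ip (cvec n p) (mulVecE (matA (n+1)) x + u • vecb (n+1)) =
      ip (cvec n p) (vecb (n+1)) * (u - ip p x) - x (Fin.last n) := by
  set N := (matA (n+1))ᵀ + vecMulVec (ef p) (vecbf (n+1)) with hN
  have hNt : matA (n+1) + vecMulVec (vecbf (n+1)) (ef p) = Nᵀ := by
    simp [hN, Matrix.transpose_vecMulVec]
  have hdet : N.det ≠ 0 := by
    intro h0
    obtain ⟨v, hv, hv0⟩ := Matrix.exists_mulVec_eq_zero_iff.2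
      (show Nᵀ.det = 0 by rwa [Matrix.det_transpose])
    have h := hneg.dotProduct_mulVec_pos hv
    have hv' : v ᵥ* N = 0 := by rwa [Matrix.mulVec_transpose] at hv0
    rw [hNt, Matrix.neg_mulVec, Matrix.add_mulVec, ← Matrix.mulVec_mulVec, hv0,
      ← Matrix.mulVec_mulVec, star_trivial, dotProduct_neg, dotProduct_add,
      Matrix.dotProduct_mulVec v N, hv'] at h
    simp at h
  have hc : N *ᵥ ef (cvec n p) = -Pi.single (Fin.last n) 1 := by
    change N *ᵥ (-(N⁻¹ *ᵥ _)) = _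
    rw [Matrix.mulVec_neg, Matrix.mulVec_mulVec, Matrix.mul_nonsing_inv _ hdet.isUnit,
      Matrix.one_mulVec]
  have hA : ef (mulVecE (matA (n+1)) x + u • vecb (n+1)) =
      Nᵀ *ᵥ ef x + (u - ip p x) • vecbf (n+1) := by
    rw [← hNt, Matrix.add_mulVec, Matrix.vecMulVec_mulVec]
    have : ip p x = ef p ⬝ᵥ ef x := rfl
    ext i
    simp only [this, ef, mulVecE, vecb, Pi.add_apply, Pi.smul_apply, PiLp.add_apply,
      PiLp.smul_apply, smul_eq_mul, MulOpposite.smul_eq_mul_unop, MulOpposite.unop_op,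
      WithLp.equiv_symm_apply]
    ring
  rw [ip_eq_dotProduct, hA, dotProduct_add, Matrix.dotProduct_mulVec, Matrix.vecMul_transpose, hc,
    dotProduct_smul]
  have : ip (cvec n p) (vecb (n+1)) = ef (cvec n p) ⬝ᵥ vecbf (n+1) := rfl
  rw [this]
  simp [ef]
  ring

/-- On a compact set, a strict inequality `φ < 0` that holds where `ψ ≤ 0` persists, with a uniform
margin, where `ψ` is slightly positive. -/
theorem IsCompact.exists_margin {X : Type*} [TopologicalSpace X] {C : Set X} (hC : IsCompact C)
    {φ ψ : X → ℝ} (hφ : Continuous φ) (hψ : Continuous ψ)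
    (h : ∀ x ∈ C, ψ x ≤ 0 → φ x < 0) :
    ∃ η > 0, ∀ x ∈ C, ψ x < η → φ x ≤ -η := by
  obtain ⟨η, hη, hle⟩ := hC.exists_forall_le' (f := fun x => max (ψ x) (-φ x)) (a := 0)
    (hψ.max hφ.neg).continuousOn fun x hx => by
      by_cases h0 : ψ x ≤ 0
      · exact lt_max_of_lt_right (by linarith [h x hx h0])
      · exact lt_max_of_lt_left (not_le.1 h0)
  refine ⟨η, hη, fun x hx hlt => ?_⟩
  rcases le_max_iff.1 (hle x hx) with h1 | h1 <;> linarith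

/-- An integral function whose derivative is bounded above by `B` grows at rate at most `B`. -/
theorem sub_le_mul_of_ae_deriv_le {ζ ζ' : ℝ → ℝ} (hint : ∀ T : ℝ, IntervalIntegrable ζ' volume 0 T)
    (hζ : ∀ t : ℝ, 0 ≤ t → ζ t = ζ 0 + ∫ s in (0:ℝ)..t, ζ' s) {a b B : ℝ} (ha : 0 ≤ a)
    (hab : a ≤ b) (hB : ∀ᵐ r ∂volume.restrict (Ico a b), ζ' r ≤ B) :
    ζ b - ζ a ≤ B * (b - a) := by
  have hii : IntervalIntegrable ζ' volume a b := (hint a).symm.trans (hint b)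
  have h1 : ζ b - ζ a = ∫ s in a..b, ζ' s := by
    rw [hζ b (ha.trans hab), hζ a ha, ← intervalIntegral.integral_interval_sub_left (hint b) (hint a)]
    ring
  have hae : volume.restrict (Icc a b) = volume.restrict (Ico a b) :=
    Measure.restrict_congr_set Ico_ae_eq_Icc.symm
  have h2 : ∫ s in a..b, ζ' s ≤ ∫ _ in a..b, B :=
    intervalIntegral.integral_mono_ae_restrict hab hii intervalIntegrable_const (by rw [hae]; exact hB)
  rw [h1]
  simpa [mul_comm] using h2

theorem abs_sub_le_mul_of_ae_abs_deriv_le {ζ ζ' : ℝ → ℝ}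
    (hint : ∀ T : ℝ, IntervalIntegrable ζ' volume 0 T)
    (hζ : ∀ t : ℝ, 0 ≤ t → ζ t = ζ 0 + ∫ s in (0:ℝ)..t, ζ' s) {a b B : ℝ} (ha : 0 ≤ a)
    (hab : a ≤ b) (hB : ∀ᵐ r ∂volume.restrict (Ico a b), |ζ' r| ≤ B) :
    |ζ b - ζ a| ≤ B * (b - a) := by
  rw [abs_le]
  constructor
  · have := sub_le_mul_of_ae_deriv_le (ζ := fun t => -ζ t) (ζ' := fun t => -ζ' t) (B := B)
      (fun T => (hint T).neg)
      (fun t ht => by rw [hζ t ht, intervalIntegral.integral_neg]; ring) ha hab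
      (hB.mono fun r hr => by linarith [neg_abs_le (ζ' r)])
    linarith
  · exact sub_le_mul_of_ae_deriv_le hint hζ ha hab (hB.mono fun r hr => (le_abs_self _).trans hr)

theorem sat_neg (s : ℝ) : sat (-s) = -sat s := by
  simp [sat, neg_div]

theorem abs_sat_le_one (s : ℝ) : |sat s| ≤ 1 := by
  have h : 0 < max 1 |s| := lt_max_of_lt_left one_pos
  rw [sat, abs_div, abs_of_pos h, div_le_one h]
  exact le_max_right _ _

theorem le_sat {a s : ℝ} (ha0 : 0 ≤ a) (ha1 : a ≤ 1) (has : a ≤ s) : a ≤ sat s := by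
  have h : 0 < max 1 |s| := lt_max_of_lt_left one_pos
  rw [sat, le_div_iff₀ h, abs_of_nonneg (ha0.trans has)]
  rcases max_cases 1 s with ⟨h, _⟩ | ⟨h, _⟩ <;> rw [h] <;> nlinarith

/-- One sampling interval of the saturated feedback: if `ζ' ≈ -κ sat (ω ζ(a))`, up to an error
which is smaller than `κ` by a margin, then `|ζ|` decreases at a uniform rate until it is at
most `ω⁻¹`. -/
theorem abs_le_max_of_sampled_sat {ζ ζ' : ℝ → ℝ}
    (hint : ∀ T : ℝ, IntervalIntegrable ζ' volume 0 T)
    (hζ : ∀ t : ℝ, 0 ≤ t → ζ t = ζ 0 + ∫ s in (0:ℝ)..t, ζ' s) {a b κ μ ω : ℝ} (ha : 0 ≤ a)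
    (hκ : 0 ≤ κ) (hμ : 0 ≤ μ) (hω : 0 < ω) (h1 : κ * (ω * (2 * κ * (b - a))) ≤ μ)
    (h2 : 2 * κ * (b - a) ≤ ω⁻¹)
    (hder : ∀ᵐ r ∂volume.restrict (Ico a b), |ζ' r + κ * sat (ω * ζ a)| ≤ κ - 2 * μ)
    {t : ℝ} (hat : a ≤ t) (htb : t ≤ b) :
    |ζ t| ≤ max ω⁻¹ (|ζ a| - μ * (t - a)) := by
  wlog hpos : 0 ≤ ζ a generalizing ζ ζ'
  · have := this (ζ := fun t => -ζ t) (ζ' := fun t => -ζ' t) (fun T => (hint T).neg)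
      (fun t ht => by rw [hζ t ht, intervalIntegral.integral_neg]; ring)
      (hder.mono fun r hr => by
        rw [mul_neg, sat_neg, ← abs_neg]
        convert hr using 2
        ring) (by linarith)
    simpa only [abs_neg] using this
  have hder' : ∀ᵐ r ∂volume.restrict (Ico a t), |ζ' r + κ * sat (ω * ζ a)| ≤ κ - 2 * μ :=
    ae_restrict_of_ae_restrict_of_subset (Ico_subset_Ico_right htb) hder
  have hmov : |ζ t - ζ a| ≤ 2 * κ * (t - a) :=
    abs_sub_le_mul_of_ae_abs_deriv_le hint hζ ha hat <| hder'.mono fun r hr => by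
      obtain ⟨hr1, hr2⟩ := abs_le.1 hr
      obtain ⟨hs1, hs2⟩ := abs_le.1 (abs_sat_le_one (ω * ζ a))
      rw [abs_le]
      constructor <;> nlinarith
  have hmov' : |ζ t - ζ a| ≤ 2 * κ * (b - a) := hmov.trans (by gcongr)
  obtain ⟨hm1, hm2⟩ := abs_le.1 hmov'
  have hωω : ω * ω⁻¹ = 1 := mul_inv_cancel₀ hω.ne'
  by_cases hnear : ω⁻¹ - 2 * κ * (b - a) ≤ ζ a
  · have hba : 0 ≤ 2 * κ * (b - a) := (abs_nonneg _).trans hmov'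
    have hsat : 1 - ω * (2 * κ * (b - a)) ≤ sat (ω * ζ a) :=
      le_sat (by nlinarith) (by nlinarith) (by nlinarith)
    have hdec : ζ t - ζ a ≤ -μ * (t - a) :=
      sub_le_mul_of_ae_deriv_le hint hζ ha hat <| hder'.mono fun r hr => by
        have := (abs_le.1 hr).2
        nlinarith [mul_le_mul_of_nonneg_left hsat hκ]
    rw [abs_of_nonneg hpos, abs_le]
    constructor
    · linarith [le_max_left ω⁻¹ (ζ a - μ * (t - a))]
    · linarith [le_max_right ω⁻¹ (ζ a - μ * (t - a))]
  · refine le_max_of_le_left ?_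
    rw [abs_le]
    constructor <;> linarith

/-- One sampling interval of the state: a trajectory which starts inside the ellipsoid cannot leave
it, because the vector field with the held input `u` points inwards near the boundary as long as
`u - p'x` is only slightly larger than `κ`, and `p'x` changes slowly. -/
theorem qf_lt_of_sampled {E : Type*} {m : ℕ} {P : Matrix (Fin m) (Fin m) ℝ} (hP : P.PosDef)
    {D : Set E} {F : E → EuclideanSpace ℝ (Fin m) → EuclideanSpace ℝ (Fin m)}
    {p : EuclideanSpace ℝ (Fin m)} {ρ κ η V u : ℝ} (hη : 0 < η) (hV : 0 ≤ V)
    (hin : ∀ d ∈ D, ∀ v w, qf P v ≤ ρ → qf P w ≤ ρ → ρ - qf P v < η → ‖w - v‖ < η →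
      |u - ip p v| - κ < η → ip w (mulVecE P (F d v)) ≤ -η)
    (hbd : ∀ d ∈ D, ∀ v, qf P v ≤ ρ → |ip p (F d v)| ≤ V)
    {d : ℝ → E} (hd : ∀ t, d t ∈ D) {x x' : ℝ → EuclideanSpace ℝ (Fin m)}
    (hint : ∀ T : ℝ, IntervalIntegrable x' volume 0 T)
    (hx : ∀ t : ℝ, 0 ≤ t → x t = x 0 + ∫ s in (0:ℝ)..t, x' s) {a b : ℝ} (ha : 0 ≤ a)
    (hVab : V * (b - a) < η)
    (hder : ∀ᵐ r ∂volume.restrict (Ico a b), x' r = F (d r) (x r))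
    (hu : |u - ip p (x a)| ≤ κ) (h0 : qf P (x a) < ρ) {t : ℝ} (hat : a ≤ t) (htb : t ≤ b) :
    qf P (x t) < ρ ∧ |ip p (x t) - ip p (x a)| ≤ V * (t - a) := by
  have hsymm : Pᵀ = P := hP.isHermitian
  have hlin : ∀ w : EuclideanSpace ℝ (Fin m),
      (∀ T : ℝ, IntervalIntegrable (fun r => ip w (x' r)) volume 0 T) ∧
      ∀ t : ℝ, 0 ≤ t → ip w (x t) = ip w (x 0) + ∫ s in (0:ℝ)..t, ip w (x' s) := by
    intro w
    simp only [ip_eq_inner]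
    refine ⟨fun T => ⟨(hint T).1.const_inner w, (hint T).2.const_inner w⟩, fun t ht => ?_⟩
    rw [hx t ht, inner_add_right]
    congr 1
    exact ((innerSL ℝ w).intervalIntegral_comp_comm (hint t)).symm
  have hcont : ContinuousOn x (Icc a b) := by
    have h1 : Continuous fun t => x 0 + ∫ s in (0:ℝ)..t, x' s :=
      continuous_const.add (intervalIntegral.continuous_primitive
        (fun s t => (hint s).symm.trans (hint t)) 0)
    exact h1.continuousOn.congr fun t ht => hx t (ha.trans ht.1)
  have hslow : ∀ s ∈ Icc a b, (∀ r ∈ Ico a s, qf P (x r) < ρ) →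
      |ip p (x s) - ip p (x a)| ≤ V * (s - a) := by
    intro s hs hr
    refine abs_sub_le_mul_of_ae_abs_deriv_le (hlin p).1 (hlin p).2 ha hs.1 ?_
    filter_upwards [ae_restrict_of_ae_restrict_of_subset (Ico_subset_Ico_right hs.2) hder,
      ae_restrict_mem measurableSet_Ico] with r h1 h2
    rw [h1]
    exact hbd _ (hd r) _ (hr r h2).le
  have hmain : ∀ s ∈ Icc a b, qf P (x s) < ρ := by
    have hq : ContinuousOn (fun s => qf P (x s)) (Icc a b) :=
      (Continuous.qf P continuous_id).comp_continuousOn hcont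
    by_contra! hcon
    obtain ⟨s₀, hs₀, hs₀'⟩ := hcon
    have hcpt : IsCompact (Icc a b ∩ (fun s => qf P (x s)) ⁻¹' Ici ρ) :=
      isCompact_Icc.of_isClosed_subset (hq.preimage_isClosed_of_isClosed isClosed_Icc isClosed_Ici)
        inter_subset_left
    obtain ⟨c, ⟨hcI, hcρ⟩, hleast⟩ := hcpt.exists_isLeast ⟨s₀, hs₀, hs₀'⟩
    have hbefore : ∀ r ∈ Ico a c, qf P (x r) < ρ := by
      intro r hr
      by_contra! h
      exact absurd (hleast ⟨⟨hr.1, hr.2.le.trans hcI.2⟩, h⟩) (not_le.2 hr.2)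
    have hac : a < c := by
      refine lt_of_le_of_ne hcI.1 ?_
      rintro rfl
      exact absurd hcρ (not_le.2 h0)
    have hcρ' : qf P (x c) ≤ ρ := by
      have h1 : c ∈ closure (Ico a c) := by
        rw [closure_Ico hac.ne]
        exact right_mem_Icc.2 hac.le
      exact ContinuousWithinAt.closure_le h1
        ((hq c hcI).mono fun r hr => ⟨hr.1, hr.2.le.trans hcI.2⟩) continuousWithinAt_const
        fun r hr => (hbefore r hr).le
    have hev : ∀ᶠ r in nhdsWithin c (Iic c), r ∈ Icc a b ∧ ρ - qf P (x r) < η ∧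
        ‖x c - x r‖ < η := by
      have hle : nhdsWithin c (Iic c) ≤ nhdsWithin c (Icc a b) := by
        rw [← nhdsWithin_Icc_eq_nhdsLE hac]
        exact nhdsWithin_mono _ (Icc_subset_Icc_right hcI.2)
      refine hle ?_
      have e1 : Tendsto (fun r => ρ - qf P (x r)) (nhdsWithin c (Icc a b))
        (nhds (ρ - qf P (x c))) := (hq c hcI).const_sub ρ
      have e2 : Tendsto (fun r => ‖x c - x r‖) (nhdsWithin c (Icc a b))
        (nhds ‖x c - x c‖) := ((hcont c hcI).const_sub (x c)).norm
      filter_upwards [self_mem_nhdsWithin, e1.eventually_lt_const (u := η) (by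
        have : ρ ≤ qf P (x c) := hcρ
        linarith), e2.eventually_lt_const (u := η) (by simpa using hη)] with r h1 h2 h3
      exact ⟨h1, h2, h3⟩
    obtain ⟨s, hsc, hs⟩ := mem_nhdsLE_iff_exists_Icc_subset.1 hev
    have hsc : s < c := hsc
    have hsI : s ∈ Icc a b := (hs (left_mem_Icc.2 hsc.le)).1
    have hstep := sub_le_mul_of_ae_deriv_le (hlin (mulVecE P (x c))).1 (hlin (mulVecE P (x c))).2
      (a := s) (b := c) (B := -η) (ha.trans hsI.1) hsc.le (by
        filter_upwards [ae_restrict_of_ae_restrict_of_subset (Ico_subset_Ico hsI.1 hcI.2) hder,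
          ae_restrict_mem measurableSet_Ico] with r h1 h2
        have hra : a ≤ r := hsI.1.trans h2.1
        obtain ⟨hr1, hr2, hr3⟩ := hs ⟨h2.1, h2.2.le⟩
        have hsl := hslow r hr1 fun r' hr' => hbefore r' ⟨hr'.1, hr'.2.trans h2.2⟩
        have hVr : V * (r - a) ≤ V * (b - a) := by gcongr; exact hr1.2
        have h3 := hin _ (hd r) (x r) (x c) (hbefore r ⟨hra, h2.2⟩).le hcρ' hr2 hr3 (by
          have := abs_sub_le u (ip p (x a)) (ip p (x r))
          rw [abs_sub_comm (ip p (x a))] at this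
          linarith)
        rwa [h1, ← hsymm, ← ip_mulVecE])
    have hconv := qf_add_two_mul_ip_le hP (x c) (x s)
    rw [ip_mulVecE, hsymm, ip_mulVecE, hsymm] at hconv
    have h4 := hbefore s ⟨hsI.1, hsc⟩
    have h5 : ρ ≤ qf P (x c) := hcρ
    have h6 : 0 < η * (c - s) := mul_pos hη (sub_pos.2 hsc)
    linarith
  exact ⟨hmain t ⟨hat, htb⟩, hslow t ⟨hat, htb⟩ fun r hr => hmain r ⟨hr.1, hr.2.le.trans htb⟩⟩

/-- **Lemma 3.4.** Under conditions (3.3)–(3.5), for sufficiently small `r̃ > 0` there is a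
continuous `T : ℝ → ℝ≥0` such that along any solution of (3.7) starting with `x(0)'Px(0) < R²`,
the quantity `z(t) = y(t) + c'x(t)` satisfies `|z(t)| ≤ max(|z(0)|, ω⁻¹)` for all `t ≥ 0`
and `|z(t)| ≤ ω⁻¹` for `t ≥ T(z(0))`. -/
theorem lemma_3_4 (n l : ℕ)
    (D : Set (EuclideanSpace ℝ (Fin l))) (hD : D.Nonempty) (hDc : IsCompact D)
    (f : EuclideanSpace ℝ (Fin l) → EuclideanSpace ℝ (Fin (n+1)) → ℝ → EuclideanSpace ℝ (Fin (n+1)))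
    (g : EuclideanSpace ℝ (Fin l) → EuclideanSpace ℝ (Fin (n+1)) → ℝ → ℝ)
    (hfLip : LocallyLipschitz
      (fun q : EuclideanSpace ℝ (Fin l) × EuclideanSpace ℝ (Fin (n+1)) × ℝ => f q.1 q.2.1 q.2.2))
    (hgLip : LocallyLipschitz
      (fun q : EuclideanSpace ℝ (Fin l) × EuclideanSpace ℝ (Fin (n+1)) × ℝ => g q.1 q.2.1 q.2.2))
    (hf0 : ∀ d ∈ D, f d 0 0 = 0) (hg0 : ∀ d ∈ D, g d 0 0 = 0)
    (P : Matrix (Fin (n+1)) (Fin (n+1)) ℝ) (hP : P.PosDef)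
    (p : EuclideanSpace ℝ (Fin (n+1)))
    (hneg : (-(P * (matA (n+1) + vecMulVec (vecbf (n+1)) (ef p))
        + ((matA (n+1))ᵀ + vecMulVec (ef p) (vecbf (n+1))) * P)).PosDef)
    (M R K ω δ : ℝ) (hM : 0 < M) (hR : 0 < R) (hK : 0 < K) (hω : 0 < ω) (hδ : 0 < δ)
    (h33 : Cond33 D f P p R K) (h34 : Cond34 D f g P p R K)
    (h35 : Cond35 D f g P p M R K ω δ)
    (k : EuclideanSpace ℝ (Fin (n+1)) → ℝ) (hk0 : k 0 = 0)
    (hkb : ∀ C : ℝ, ∃ B : ℝ, ∀ x : EuclideanSpace ℝ (Fin (n+1)), ‖x‖ ≤ C → |k x| ≤ B) :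
    ∃ rt : ℝ, 0 < rt ∧
      ∃ T : ℝ → ℝ, Continuous T ∧ (∀ s : ℝ, 0 ≤ T s) ∧
        ∀ (τ : ℕ → ℝ) (d : ℝ → EuclideanSpace ℝ (Fin l))
          (x : ℝ → EuclideanSpace ℝ (Fin (n+1))) (y : ℝ → ℝ),
          Sched rt τ → Measurable d → (∀ t : ℝ, d t ∈ D) →
          Sol37 f g (ktilde k P p R K ω) τ d x y →
          qf P (x 0) < R ^ 2 →
          (∀ t : ℝ, 0 ≤ t →
              |y t + ip (cvec n p) (x t)| ≤ max (|y 0 + ip (cvec n p) (x 0)|) ω⁻¹) ∧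
          (∀ t : ℝ, T (y 0 + ip (cvec n p) (x 0)) ≤ t →
              |y t + ip (cvec n p) (x t)| ≤ ω⁻¹) := by
  have hfc := hfLip.continuous
  have hgc := hgLip.continuous
  set c := cvec n p with hc
  set b := vecb (n+1) with hb
  set κ := K * |ip c b| with hκ
  have hκ0 : 0 ≤ κ := by positivity
  have hE := isCompact_setOf_qf_le hP (R ^ 2)
  obtain ⟨Bp, hBp⟩ := hE.exists_bound_of_continuousOn (f := fun v => ip p v)
    (Continuous.ip continuous_const continuous_id).continuousOn
  have hU : ∀ v u, qf P v ≤ R ^ 2 → |u - ip p v| ≤ κ → u ∈ Icc (-(Bp + κ)) (Bp + κ) := by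
    intro v u hv hu
    have h1 : |ip p v| ≤ Bp := hBp v hv
    rw [abs_le] at h1 hu
    constructor <;> linarith [h1.1, h1.2, hu.1, hu.2]
  set I := Icc (-(Bp + κ)) (Bp + κ) with hI
  set E := {v : EuclideanSpace ℝ (Fin (n+1)) | qf P v ≤ R ^ 2} with hEdef
  obtain ⟨η₁, hη₁, hin⟩ := (hDc.prod (hE.prod (hE.prod (isCompact_Icc (a := -(Bp + κ))
    (b := Bp + κ))))).exists_margin
    (φ := fun q => ip q.2.2.1
      (mulVecE P (mulVecE (matA (n+1)) q.2.1 + f q.1 q.2.1 q.2.2.2 + q.2.2.2 • b)))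
    (ψ := fun q => max (R ^ 2 - qf P q.2.1)
      (max ‖q.2.2.1 - q.2.1‖ (|q.2.2.2 - ip p q.2.1| - κ)))
    (Continuous.ip (by fun_prop) (Continuous.mulVecE P (Continuous.add (Continuous.add
      (Continuous.mulVecE _ (by fun_prop))
      (hfc.comp (f := fun q : EuclideanSpace ℝ (Fin l) × EuclideanSpace ℝ (Fin (n+1)) ×
        EuclideanSpace ℝ (Fin (n+1)) × ℝ => (q.1, q.2.1, q.2.2.2)) (by fun_prop)))
      (by fun_prop))))
    ((continuous_const.sub (Continuous.qf P (by fun_prop))).max (Continuous.max (by fun_prop)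
      ((Continuous.abs (Continuous.sub (by fun_prop)
        (Continuous.ip continuous_const (by fun_prop)))).sub continuous_const)))
    (by
      rintro ⟨d, v, w, u⟩ ⟨hd, hv, hw, hu⟩ hψ
      simp only [max_le_iff, norm_le_zero_iff, sub_eq_zero] at hψ hv hw hu ⊢
      obtain ⟨hψ1, rfl, hψ2⟩ := hψ
      exact h33 d hd w u (le_antisymm hv (by linarith)) (by linarith))
  obtain ⟨η₂, hη₂, hdr⟩ := (hDc.prod (hE.prod (isCompact_Icc (a := -(Bp + κ))
    (b := Bp + κ)))).exists_margin
    (φ := fun q => |g q.1 q.2.1 q.2.2 + ip c (f q.1 q.2.1 q.2.2)| - K * ip c b ^ 2)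
    (ψ := fun q => |q.2.2 - ip p q.2.1| - κ)
    ((hgc.add (continuous_const.ip hfc)).abs.sub continuous_const)
    ((Continuous.abs (Continuous.sub (by fun_prop)
        (Continuous.ip continuous_const (by fun_prop)))).sub continuous_const)
    (by
      rintro ⟨d, v, u⟩ ⟨hd, hv, hu⟩ hψ
      have := h34 d hd v u hv (by simpa using hψ)
      simpa using this)
  obtain ⟨V₀, hV₀⟩ := (hDc.prod (hE.prod (isCompact_Icc (a := -(Bp + κ))
    (b := Bp + κ)))).exists_bound_of_continuousOn
    (f := fun q => ip p (mulVecE (matA (n+1)) q.2.1 + f q.1 q.2.1 q.2.2 + q.2.2 • b))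
    (Continuous.ip continuous_const (Continuous.add (Continuous.add
      (Continuous.mulVecE _ (by fun_prop)) hfc) (by fun_prop))).continuousOn
  set V := max V₀ 0 with hV
  have hV0 : 0 ≤ V := le_max_right _ _
  set η := min η₁ η₂ with hη
  have hη0 : 0 < η := lt_min hη₁ hη₂
  set γ := K * ip c b ^ 2 with hγ
  have hγ0 : 0 ≤ γ := by positivity
  set Q := 1 + V + |ip c b| * V + γ * (ω * (2 * γ)) + 2 * γ with hQ
  have hQ0 : 0 < Q := by positivity
  set rt := min (η / 3) ω⁻¹ / Q with hrt
  have hrt0 : 0 < rt := div_pos (lt_min (by positivity) (by positivity)) hQ0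
  have hQrt : Q * rt = min (η / 3) ω⁻¹ := mul_div_cancel₀ _ hQ0.ne'
  have hQ1 : Q * rt ≤ η / 3 := hQrt.trans_le (min_le_left _ _)
  have hQ2 : Q * rt ≤ ω⁻¹ := hQrt.trans_le (min_le_right _ _)
  have hcoef : ∀ a s, 0 ≤ s → s ≤ rt → a ≤ Q → a * s ≤ Q * rt := fun a s h1 h2 h3 =>
    mul_le_mul h3 h2 h1 hQ0.le
  have hp1 : 0 ≤ |ip c b| * V := by positivity
  have hp2 : 0 ≤ γ * (ω * (2 * γ)) := by positivity
  refine ⟨rt, hrt0, fun s => |s| / (η / 3), by fun_prop, fun s => by positivity, ?_⟩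
  rintro τ d x y ⟨hτ0, hτpos, hτle, hτtop⟩ - hd ⟨x', y', hx'i, hy'i, hx, hy, hsol⟩ hx0
  set ζ := fun t => y t + ip c (x t) with hζdef
  set ζ' := fun t => y' t + ip c (x' t) with hζ'def
  have hζi : ∀ T : ℝ, IntervalIntegrable ζ' volume 0 T := fun T => (hy'i T).add <| by
    simp only [ip_eq_inner]
    exact ⟨(hx'i T).1.const_inner c, (hx'i T).2.const_inner c⟩
  have hζ : ∀ t : ℝ, 0 ≤ t → ζ t = ζ 0 + ∫ s in (0:ℝ)..t, ζ' s := by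
    intro t ht
    have h1 : IntervalIntegrable (fun s => inner ℝ c (x' s)) volume 0 t :=
      ⟨(hx'i t).1.const_inner c, (hx'i t).2.const_inner c⟩
    have h2 : ∫ s in (0:ℝ)..t, inner ℝ c (x' s) = inner ℝ c (∫ s in (0:ℝ)..t, x' s) :=
      (innerSL ℝ c).intervalIntegral_comp_comm (hx'i t)
    simp only [hζdef, hζ'def, ip_eq_inner]
    rw [intervalIntegral.integral_add (hy'i t) h1, h2, hy t ht, hx t ht, inner_add_right]
    ring
  have hτmono : StrictMono τ := strictMono_nat_of_lt_succ fun i => sub_pos.1 (hτpos i)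
  have hstep : ∀ i, qf P (x (τ i)) < R ^ 2 → ∀ t, τ i ≤ t → t ≤ τ (i+1) →
      qf P (x t) < R ^ 2 ∧ |ζ t| ≤ max ω⁻¹ (|ζ (τ i)| - η / 3 * (t - τ i)) := by
    intro i hi t hit hti
    have hi0 : 0 ≤ τ i := hτ0 ▸ hτmono.monotone (Nat.zero_le i)
    have hlen0 : 0 ≤ τ (i+1) - τ i := (hτpos i).le
    set u := ktilde k P p R K ω (x (τ i)) (y (τ i)) with hudef
    have hu : u = ip p (x (τ i)) - K * ip c b * sat (ω * ζ (τ i)) := if_neg (not_le.2 hi)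
    have huκ : |u - ip p (x (τ i))| ≤ κ := by
      have h1 : |u - ip p (x (τ i))| = κ * |sat (ω * ζ (τ i))| := by
        rw [hu, sub_sub_cancel_left, abs_neg, abs_mul, abs_mul, abs_of_pos hK]
      rw [h1]
      exact mul_le_of_le_one_right hκ0 (abs_sat_le_one _)
    have huI : u ∈ I := hU _ _ hi.le huκ
    have hxs := fun t => qf_lt_of_sampled hP (D := D) (p := p) (κ := κ) (u := u) (t := t)
      (F := fun d v => mulVecE (matA (n+1)) v + f d v u + u • b) hη0 hV0
      (fun d hd v w hv hw h1 h2 h3 => (hin (d, v, w, u) ⟨hd, hv, hw, huI⟩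
        ((max_lt h1 (max_lt h2 h3)).trans_le (min_le_left _ _))).trans
          (neg_le_neg (min_le_left _ _)))
      (fun d hd v hv => (hV₀ (d, v, u) ⟨hd, hv, huI⟩).trans (le_max_left _ _))
      hd hx'i hx (a := τ i) (b := τ (i+1)) hi0
      (by
        have := hcoef V _ hlen0 (hτle i) (by linarith)
        linarith) ((hsol i).mono fun r hr => hr.1) huκ hi
    refine ⟨(hxs t hit hti).1, abs_le_max_of_sampled_sat hζi hζ hi0 hγ0 (by positivity) hω
      (b := τ (i+1)) ?_ ?_ ?_ hit hti⟩
    · have := hcoef (γ * (ω * (2 * γ))) _ hlen0 (hτle i) (by linarith)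
      linarith
    · exact (hcoef (2 * γ) _ hlen0 (hτle i) (by linarith)).trans hQ2
    · filter_upwards [hsol i, ae_restrict_mem measurableSet_Ico] with r ⟨hr1, hr2⟩ hr
      obtain ⟨hq, hslow⟩ := hxs r hr.1 hr.2.le
      have hVr : V * (r - τ i) ≤ η / 3 :=
        (hcoef V _ (by linarith [hr.1]) (by linarith [hr.2, hτle i]) (by linarith)).trans hQ1
      have hcVr : |ip c b| * V * (r - τ i) ≤ η / 3 :=
        (hcoef _ _ (by linarith [hr.1]) (by linarith [hr.2, hτle i]) (by linarith)).trans hQ1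
      have h1 : |u - ip p (x r)| - κ < η₂ := by
        have h := abs_sub_le u (ip p (x (τ i))) (ip p (x r))
        rw [abs_sub_comm (ip p (x (τ i)))] at h
        have : η ≤ η₂ := min_le_right _ _
        linarith
      have h2 := hdr (d r, x r, u) ⟨hd r, hq.le, huI⟩ h1
      have h3 : ip c (x' r) = ip c b * (u - ip p (x r)) - x r (Fin.last n) +
          ip c (f (d r) (x r) u) := by
        rw [hc, hb, ← ip_cvec_mulVecE hneg, hr1]
        simp only [ip_eq_inner, inner_add_right]
        ring
      have h4 : ζ' r + γ * sat (ω * ζ (τ i)) = (g (d r) (x r) u + ip c (f (d r) (x r) u)) -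
          ip c b * (ip p (x r) - ip p (x (τ i))) := by
        simp only [hζ'def, h3, hr2, ← hudef]
        generalize g (d r) (x r) u = G, f (d r) (x r) u = H
        rw [hu, hγ]
        ring
      rw [h4]
      have h5 : |ip c b * (ip p (x r) - ip p (x (τ i)))| ≤ |ip c b| * V * (r - τ i) := by
        rw [abs_mul, mul_assoc]
        gcongr
      have h6 := abs_sub (g (d r) (x r) u + ip c (f (d r) (x r) u))
        (ip c b * (ip p (x r) - ip p (x (τ i))))
      have : η ≤ η₂ := min_le_right _ _
      simp only at h2
      linarith
  have hsample : ∀ i, qf P (x (τ i)) < R ^ 2 ∧ |ζ (τ i)| ≤ max ω⁻¹ (|ζ 0| - η / 3 * τ i) := by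
    intro i
    induction i with
    | zero => simpa [hτ0] using hx0
    | succ i ih =>
      obtain ⟨h1, h2⟩ := hstep i ih.1 (τ (i+1)) (hτmono i.lt_succ_self).le le_rfl
      refine ⟨h1, h2.trans (max_le (le_max_left _ _) ?_)⟩
      have h3 : 0 < η / 3 * (τ (i+1) - τ i) := mul_pos (by positivity) (hτpos i)
      rcases le_max_iff.1 ih.2 with h | h
      · exact le_max_of_le_left (by linarith)
      · exact le_max_of_le_right (by linarith)
  have hall : ∀ t, 0 ≤ t → |ζ t| ≤ max ω⁻¹ (|ζ 0| - η / 3 * t) := by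
    intro t ht
    obtain ⟨i, hi, hi'⟩ : ∃ i, τ i ≤ t ∧ t ≤ τ (i+1) := by
      classical
      have hex : ∃ j, t < τ j := (hτtop.eventually_gt_atTop t).exists
      obtain ⟨i, hi⟩ : ∃ i, Nat.find hex = i + 1 := Nat.exists_eq_succ_of_ne_zero fun h => by
        have := Nat.find_spec hex
        rw [h, hτ0] at this
        linarith
      exact ⟨i, not_lt.1 (Nat.find_min hex (by omega)), hi ▸ (Nat.find_spec hex).le⟩
    have h3 : 0 ≤ η / 3 * (t - τ i) := mul_nonneg (by positivity) (sub_nonneg.2 hi)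
    refine (hstep i (hsample i).1 t hi hi').2.trans (max_le (le_max_left _ _) ?_)
    rcases le_max_iff.1 (hsample i).2 with h | h
    · exact le_max_of_le_left (by linarith)
    · exact le_max_of_le_right (by linarith)
  constructor
  · intro t ht
    refine (hall t ht).trans (max_le (le_max_right _ _) (le_max_of_le_left ?_))
    have : 0 ≤ η / 3 * t := by positivity
    linarith
  · intro t ht
    have ht0 : 0 ≤ t := le_trans (by positivity) ht
    rw [div_le_iff₀ (by positivity)] at ht
    refine (hall t ht0).trans (max_le le_rfl ?_)
    have : (0:ℝ) < ω⁻¹ := by positivity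
    linarith
end
end

section
/- (Theorem 3.7, existence part) Consider the uncertain feedforward system (1.1) under assumption (1.2). Then there exist a bounded function k : ℝⁿ → ℝ with k(0) = 0, continuous at 0 ∈ ℝⁿ, and a constant r > 0, such that 0 ∈ ℝⁿ is RGAS for the closed-loop sampled-data system obtained from (1.1) by setting u(t) = k(x(τ_i)) on each sampling interval [τ_i, τ_{i+1}): properties P1, P2, P3 hold over all sampling schedules with MASP r, all measurable disturbances d : [0,∞) → D, and all solutions. -/
open Matrix MeasureTheory Set Filter

noncomputable section

/-- Truncation keeping the first `m` coordinates (and padding by zeros):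
this represents `x̄_m = (x₁,…,x_m)'`. -/
def truncV {n : ℕ} (m : ℕ) (x : EuclideanSpace ℝ (Fin (n+1))) : EuclideanSpace ℝ (Fin (n+1)) :=
  (WithLp.equiv 2 (Fin (n+1) → ℝ)).symm (fun i => if (i : ℕ) < m then x i else 0)

/-- A (locally absolutely continuous) solution of the closed-loop sampled-data feedforward
system (1.1) with feedback `k`, sampling times `τ` and disturbance `d`:
`ẋ₁ = u`, `ẋᵢ = x_{i-1} + gᵢ(d, x₁,…,x_{i-1}, u)` for `i = 2,…,n`, with
`u = k(x(τ_i))` held constant on each sampling interval. -/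
def FFSol {l n : ℕ}
    (g : Fin (n+1) → EuclideanSpace ℝ (Fin l) → EuclideanSpace ℝ (Fin (n+1)) → ℝ → ℝ)
    (k : EuclideanSpace ℝ (Fin (n+1)) → ℝ) (τ : ℕ → ℝ)
    (d : ℝ → EuclideanSpace ℝ (Fin l))
    (x : ℝ → EuclideanSpace ℝ (Fin (n+1))) : Prop :=
  ∃ x' : ℝ → EuclideanSpace ℝ (Fin (n+1)),
    (∀ T : ℝ, IntervalIntegrable x' volume 0 T) ∧
    (∀ t : ℝ, 0 ≤ t → x t = x 0 + ∫ s in (0:ℝ)..t, x' s) ∧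
    ∀ i : ℕ, ∀ᵐ t ∂(volume.restrict (Ico (τ i) (τ (i+1)))),
      x' t 0 = k (x (τ i)) ∧
      ∀ j : Fin (n+1), (j : ℕ) ≠ 0 →
        x' t j = x t ⟨(j : ℕ) - 1, by have := j.isLt; omega⟩
            + g j (d t) (x t) (k (x (τ i)))

/-- Iterated Pascal sums: `pascal f i k = ∑ⱼ (i choose j) f (k + j)`. -/
def pascal (f : ℕ → ℝ) : ℕ → ℕ → ℝ
  | 0, k => f k
  | i + 1, k => pascal f i k + pascal f i (k + 1)

theorem abs_pascal_le {f : ℕ → ℝ} {M : ℝ} (i k : ℕ) (h : ∀ j ≤ i + k, |f j| ≤ M) :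
    |pascal f i k| ≤ 2 ^ i * M := by
  induction i generalizing k with
  | zero => simpa [pascal] using h k (by omega)
  | succ i ih =>
    have h1 := ih k fun j hj => h j (by omega)
    have h2 := ih (k + 1) fun j hj => h j (by omega)
    calc |pascal f (i + 1) k| ≤ |pascal f i k| + |pascal f i (k + 1)| := abs_add_le _ _
      _ ≤ 2 ^ (i + 1) * M := by rw [pow_succ]; linarith

/-- The first column of the Pascal sums controls all of them, in particular `f` itself. -/
theorem abs_pascal_le_of_col {f : ℕ → ℝ} {ρ : ℝ} {m : ℕ} (h : ∀ j < m, |pascal f j 0| ≤ ρ)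
    (k i : ℕ) (hik : i + k < m) : |pascal f i k| ≤ 2 ^ k * ρ := by
  induction k generalizing i with
  | zero => simpa using h i (by omega)
  | succ k ih =>
    have h1 := ih (i + 1) (by omega)
    have h2 := ih i (by omega)
    have h3 : pascal f i (k + 1) = pascal f (i + 1) k - pascal f i k := by simp [pascal]
    calc |pascal f i (k + 1)| ≤ |pascal f (i + 1) k| + |pascal f i k| := by
          rw [h3]; exact abs_sub _ _
      _ ≤ 2 ^ (k + 1) * ρ := by rw [pow_succ]; linarith

theorem pascal_shift {f p q : ℕ → ℝ} (i k : ℕ)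
    (h : ∀ j ≤ i + k, f (j + 1) = p j + q (j + 1)) :
    pascal f i (k + 1) = pascal p i k + pascal q i (k + 1) := by
  induction i generalizing k with
  | zero => simpa [pascal] using h k (by omega)
  | succ i ih =>
    have h1 := ih k fun j hj => h j (by omega)
    have h2 := ih (k + 1) fun j hj => h j (by omega)
    simp only [pascal, h1, h2]; ring

theorem pascal_of_chain {f p q : ℕ → ℝ} (hq : q 0 = 0) (i : ℕ)
    (h : ∀ j < i, f (j + 1) = p j + q (j + 1)) :
    pascal f i 0 = f 0 + ∑ j ∈ Finset.range i, pascal p j 0 + pascal q i 0 := by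
  induction i with
  | zero => simp [pascal, hq]
  | succ i ih =>
    have h1 := ih fun j hj => h j (by omega)
    have h2 := pascal_shift (f := f) (p := p) (q := q) i 0 fun j hj => h j (by omega)
    simp only [zero_add] at h2
    simp only [pascal, zero_add, h1, h2, Finset.sum_range_succ]; ring

theorem pascal_intervalIntegrable {F : ℕ → ℝ → ℝ} {a b : ℝ}
    (h : ∀ j, IntervalIntegrable (F j) volume a b) (i k : ℕ) :
    IntervalIntegrable (fun s => pascal (fun j => F j s) i k) volume a b := by
  induction i generalizing k with
  | zero => simpa [pascal] using h k
  | succ i ih => simpa only [pascal] using (ih k).add (ih (k + 1))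

theorem pascal_eq_integral {X F : ℕ → ℝ → ℝ} {a t : ℝ}
    (h : ∀ j, IntervalIntegrable (F j) volume a t)
    (hX : ∀ j, X j t = X j a + ∫ s in a..t, F j s) (i k : ℕ) :
    pascal (fun j => X j t) i k
      = pascal (fun j => X j a) i k + ∫ s in a..t, pascal (fun j => F j s) i k := by
  induction i generalizing k with
  | zero => simpa [pascal] using hX k
  | succ i ih =>
    simp only [pascal]
    rw [intervalIntegral.integral_add (pascal_intervalIntegrable h i k)
      (pascal_intervalIntegrable h i (k + 1)), ih k, ih (k + 1)]
    ring

theorem continuous_pascal {E : Type*} [TopologicalSpace E] {F : E → ℕ → ℝ}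
    (h : ∀ j, Continuous fun e => F e j) (i k : ℕ) :
    Continuous fun e => pascal (F e) i k := by
  induction i generalizing k with
  | zero => simpa [pascal] using h k
  | succ i ih => simp only [pascal]; exact (ih k).add (ih (k + 1))

theorem pascal_zero (i k : ℕ) : pascal (fun _ => 0) i k = 0 := by
  induction i generalizing k with
  | zero => rfl
  | succ i ih => simp [pascal, ih]

/-- Truncation of a real number to `[-M, M]`. -/
def clamp (M s : ℝ) : ℝ := max (-M) (min M s)

theorem abs_clamp_le {M : ℝ} (hM : 0 ≤ M) (s : ℝ) : |clamp M s| ≤ M := by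
  unfold clamp
  exact abs_le.2 ⟨le_max_left _ _, max_le (by linarith) (min_le_left _ _)⟩

theorem clamp_of_abs_le {M s : ℝ} (h : |s| ≤ M) : clamp M s = s := by
  obtain ⟨h1, h2⟩ := abs_le.1 h
  rw [clamp, min_eq_right h2, max_eq_right h1]

/-- One Euler step with saturated feedback and small errors: outside a neighbourhood of the origin
the state moves towards it at a definite speed. -/
theorem abs_le_max_of_clamp_step {M h w y z : ℝ} (hM : 0 < M) (h0 : 0 ≤ h) (h1 : h ≤ 1 / 10)
    (hw : |w| ≤ M / 4) (hz : |z - y - h * -clamp M (y + w)| ≤ h * (M / 8)) :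
    |z| ≤ max (5 / 8 * M) (|y| - h * (M / 8)) := by
  obtain ⟨hw1, hw2⟩ := abs_le.1 hw
  obtain ⟨hz1, hz2⟩ := abs_le.1 hz
  have hhM : h * M ≤ M / 10 := by nlinarith
  have hhM0 : 0 ≤ h * M := by positivity
  obtain ⟨hc1, hc2⟩ := abs_le.1 (abs_clamp_le hM.le (y + w))
  have hd1 : -(h * M) ≤ h * clamp M (y + w) := by nlinarith
  have hd2 : h * clamp M (y + w) ≤ h * M := by nlinarith
  rcases le_total (|y|) (M / 2) with hy | hy
  · obtain ⟨hy1, hy2⟩ := abs_le.1 hy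
    refine le_max_of_le_left (abs_le.2 ⟨by linarith, by linarith⟩)
  · rcases le_total 0 y with hs | hs
    · rw [abs_of_nonneg hs] at hy ⊢
      have h3 : M / 4 ≤ clamp M (y + w) :=
        le_max_of_le_right (le_min (by linarith) (by linarith))
      have h4 : h * (M / 4) ≤ h * clamp M (y + w) := mul_le_mul_of_nonneg_left h3 h0
      refine abs_le.2 ⟨?_, le_max_of_le_right (by linarith)⟩
      have := le_max_left (5 / 8 * M) (y - h * (M / 8))
      linarith
    · rw [abs_of_nonpos hs] at hy ⊢
      have h3 : clamp M (y + w) ≤ -(M / 4) :=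
        max_le (by linarith) (min_le_of_right_le (by linarith))
      have h4 : h * clamp M (y + w) ≤ h * -(M / 4) := mul_le_mul_of_nonneg_left h3 h0
      refine abs_le.2 ⟨?_, le_max_of_le_left (by linarith)⟩
      have := le_max_right (5 / 8 * M) (-y - h * (M / 8))
      linarith

/-- The nested saturation
`clamp (μ / 4 ^ i) (y i + clamp (μ / 4 ^ (i + 1)) (y (i + 1) + ⋯))` with `k` levels. -/
def nestedSat (μ : ℝ) (y : ℕ → ℝ) : ℕ → ℕ → ℝ
  | 0, _ => 0
  | k + 1, i => clamp (μ / 4 ^ i) (y i + nestedSat μ y k (i + 1))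

theorem abs_nestedSat_le {μ : ℝ} (hμ : 0 ≤ μ) (y : ℕ → ℝ) (k i : ℕ) :
    |nestedSat μ y k i| ≤ μ / 4 ^ i := by
  cases k with
  | zero => simp only [nestedSat, abs_zero]; positivity
  | succ k => exact abs_clamp_le (by positivity) _

theorem div_four_pow_succ (μ : ℝ) (i : ℕ) : μ / 4 ^ (i + 1) = μ / 4 ^ i / 4 := by
  rw [pow_succ, div_div]

theorem nestedSat_eq_sum_add {μ : ℝ} (hμ : 0 ≤ μ) {y : ℕ → ℝ} (i k : ℕ)
    (h : ∀ j < i, |y j| ≤ 5 / 8 * (μ / 4 ^ j)) :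
    nestedSat μ y (k + i) 0 = ∑ j ∈ Finset.range i, y j + nestedSat μ y k i := by
  induction i generalizing k with
  | zero => simp
  | succ i ih =>
    have h1 := ih (k + 1) fun j hj => h j (by omega)
    have h2 := h i (by omega)
    have h3 := abs_nestedSat_le hμ y k (i + 1)
    rw [div_four_pow_succ] at h3
    have h4 : |y i + nestedSat μ y k (i + 1)| ≤ μ / 4 ^ i := by
      have : 0 ≤ μ / 4 ^ i := by positivity
      exact (abs_add_le _ _).trans (by linarith)
    rw [show k + (i + 1) = k + 1 + i by ring, h1, Finset.sum_range_succ, nestedSat,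
      clamp_of_abs_le h4]
    ring

theorem abs_nestedSat_le_of_small {μ ρ : ℝ} (hρ : 0 ≤ ρ) (hρμ : ρ ≤ μ) {y : ℕ → ℝ} (k i : ℕ)
    (h : ∀ j < i + k, |y j| ≤ 5 / 8 * (ρ / 4 ^ j)) : |nestedSat μ y k i| ≤ ρ / 4 ^ i := by
  induction k generalizing i with
  | zero => simp only [nestedSat, abs_zero]; positivity
  | succ k ih =>
    have h1 := ih (i + 1) fun j hj => h j (by omega)
    have h2 := h i (by omega)
    rw [div_four_pow_succ] at h1
    have h3 : |y i + nestedSat μ y k (i + 1)| ≤ ρ / 4 ^ i := by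
      have : 0 ≤ ρ / 4 ^ i := by positivity
      exact (abs_add_le _ _).trans (by linarith)
    rw [nestedSat, clamp_of_abs_le (h3.trans (by gcongr))]
    exact h3

theorem continuous_nestedSat {E : Type*} [TopologicalSpace E] (μ : ℝ) {F : E → ℕ → ℝ}
    (h : ∀ j, Continuous fun e => F e j) (k i : ℕ) :
    Continuous fun e => nestedSat μ (F e) k i := by
  induction k generalizing i with
  | zero => simpa only [nestedSat] using continuous_const
  | succ k ih =>
    simp only [nestedSat, clamp]
    exact continuous_const.max (continuous_const.min ((h i).add (ih (i + 1))))

theorem Sched.strictMono {r : ℝ} {τ : ℕ → ℝ} (h : Sched r τ) : StrictMono τ :=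
  strictMono_nat_of_lt_succ fun i => sub_pos.1 (h.2.1 i)

/-- Induction along the sampling intervals. -/
theorem Sched.induction {r : ℝ} {τ : ℕ → ℝ} (h : Sched r τ) {Q : ℝ → Prop} {N : ℕ}
    (h0 : Q (τ N)) (hs : ∀ k, N ≤ k → Q (τ k) → ∀ t ∈ Icc (τ k) (τ (k + 1)), Q t)
    {t : ℝ} (ht : τ N ≤ t) : Q t := by
  have hN : ∀ k, N ≤ k → Q (τ k) := fun k hk => by
    induction k, hk using Nat.le_induction with
    | base => exact h0
    | succ k hk ih => exact hs k hk ih _ ⟨(h.strictMono (Nat.lt_succ_self k)).le, le_rfl⟩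
  obtain ⟨M, hM⟩ := (h.2.2.2.eventually_gt_atTop t).exists
  have hex : ∃ m, t < τ m := ⟨M, hM⟩
  classical
  set m := Nat.find hex with hm
  have hm1 : t < τ m := Nat.find_spec hex
  have hm2 : N < m := h.strictMono.lt_iff_lt.1 (ht.trans_lt hm1)
  obtain ⟨k, hk⟩ : ∃ k, m = k + 1 := ⟨m - 1, by omega⟩
  have hk1 : τ k ≤ t := not_lt.1 (Nat.find_min hex (show k < Nat.find hex by omega))
  exact hs k (by omega) (hN k (by omega)) t ⟨hk1, by rw [← hk]; exact hm1.le⟩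

theorem Sched.exists_mem {r : ℝ} {τ : ℕ → ℝ} (h : Sched r τ) {T : ℝ} (hr : 0 ≤ r) (hT : 0 ≤ T) :
    ∃ N, T ≤ τ N ∧ τ N ≤ T + r := by
  have hex : ∃ m, T ≤ τ m := (h.2.2.2.eventually_ge_atTop T).exists
  classical
  refine ⟨Nat.find hex, Nat.find_spec hex, ?_⟩
  rcases Nat.eq_zero_or_pos (Nat.find hex) with h0 | h0
  · rw [h0, h.1]; linarith
  · obtain ⟨k, hk⟩ : ∃ k, Nat.find hex = k + 1 := ⟨Nat.find hex - 1, by omega⟩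
    have h1 : τ k < T := not_le.1 (Nat.find_min hex (show k < Nat.find hex by omega))
    have h2 := h.2.2.1 k
    rw [hk]; linarith

/-- On the interval `[a, b]` the functions `X 0, …, X n` form a perturbed chain of integrators
with constant input `u`; as long as the input and the preceding states are bounded by `M`, the
perturbation is bounded by `Γ M`. -/
structure IntegratorChain (n : ℕ) (Γ : ℝ → ℝ) (X X' : ℕ → ℝ → ℝ) (a b u : ℝ) : Prop where
  integrable : ∀ j, IntervalIntegrable (X' j) volume a b
  eq_integral : ∀ j, ∀ t ∈ Icc a b, X j t = X j a + ∫ s in a..t, X' j s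
  deriv_ae : ∀ᵐ t, t ∈ Ico a b → X' 0 t = u ∧ ∀ j < n, ∀ M, |u| ≤ M →
    (∀ m ≤ j, |X m t| ≤ M) → |X' (j + 1) t - X j t| ≤ Γ M

theorem IntegratorChain.mono {n : ℕ} {Γ : ℝ → ℝ} {X X' : ℕ → ℝ → ℝ} {a b c u : ℝ}
    (h : IntegratorChain n Γ X X' a b u) (hc : c ∈ Icc a b) : IntegratorChain n Γ X X' a c u where
  integrable j := (h.integrable j).mono_set (by
    rw [uIcc_of_le hc.1, uIcc_of_le (hc.1.trans hc.2)]; exact Icc_subset_Icc_right hc.2)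
  eq_integral j t ht := h.eq_integral j t ⟨ht.1, ht.2.trans hc.2⟩
  deriv_ae := h.deriv_ae.mono fun t ht htc => ht ⟨htc.1, htc.2.trans_le hc.2⟩

theorem abs_increment_sub_le {F F' : ℝ → ℝ} {a b c e : ℝ} (hab : a ≤ b)
    (hi : IntervalIntegrable F' volume a b) (hF : F b = F a + ∫ s in a..b, F' s)
    (h : ∀ᵐ t, t ∈ Ico a b → |F' t - c| ≤ e) : |F b - F a - (b - a) * c| ≤ (b - a) * e := by
  have h1 : F b - F a - (b - a) * c = ∫ s in a..b, (F' s - c) := by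
    rw [intervalIntegral.integral_sub hi intervalIntegrable_const,
      intervalIntegral.integral_const, hF, smul_eq_mul]
    ring
  have hb : ∀ᵐ t : ℝ, t ≠ b := by simp [ae_iff]
  have h2 : ∀ᵐ t, t ∈ Ioc a b → ‖F' t - c‖ ≤ e := by
    filter_upwards [h, hb] with t ht htb hab'
    exact ht ⟨hab'.1.le, lt_of_le_of_ne hab'.2 htb⟩
  have h3 := intervalIntegral.norm_integral_le_of_norm_le_const_ae
    (f := fun s => F' s - c) (a := a) (b := b) (C := e) (by rwa [uIoc_of_le hab])
  rw [h1, ← Real.norm_eq_abs]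
  rw [abs_of_nonneg (sub_nonneg.2 hab)] at h3
  linarith

/-- The `i`-th forwarding coordinate of the state `X` at time `t`. -/
def pascalCoord (X : ℕ → ℝ → ℝ) (i : ℕ) (t : ℝ) : ℝ := pascal (fun j => X j t) i 0

theorem abs_le_of_pascalCoord {X : ℕ → ℝ → ℝ} {t ρ : ℝ} {n i : ℕ} (hρ : 0 ≤ ρ) (hi : i ≤ n + 1)
    (h : ∀ j < i, |pascalCoord X j t| ≤ ρ) : ∀ j < i, |X j t| ≤ 2 ^ n * ρ := fun j hj => by
  refine (abs_pascal_le_of_col (f := fun j => X j t) h j 0 (by omega)).trans ?_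
  have : (2 : ℝ) ^ j ≤ 2 ^ n := pow_le_pow_right₀ (by norm_num) (by omega)
  gcongr

theorem IntegratorChain.abs_deriv_pascal_sub_le {n : ℕ} {Γ : ℝ → ℝ} {X X' : ℕ → ℝ → ℝ} {a b u ρ γ : ℝ}
    (h : IntegratorChain n Γ X X' a b u) (hρ : 0 ≤ ρ) (hu : |u| ≤ ρ) (hγ : Γ (2 ^ n * ρ) ≤ γ)
    (hγ0 : 0 ≤ γ) {i : ℕ} (hi : i ≤ n)
    (hY : ∀ j < i, ∀ t ∈ Icc a b, |pascalCoord X j t| ≤ ρ) :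
    ∀ᵐ t, t ∈ Ico a b → |pascal (fun j => X' j t) i 0
      - (u + ∑ j ∈ Finset.range i, pascalCoord X j t)| ≤ 2 ^ n * γ := by
  filter_upwards [h.deriv_ae] with t ht htab
  obtain ⟨h0, h1⟩ := ht htab
  have hX := abs_le_of_pascalCoord hρ (Nat.le_succ_of_le hi)
    fun j hj => hY j hj t (Ico_subset_Icc_self htab)
  have h2n : (1 : ℝ) ≤ 2 ^ n := one_le_pow₀ (by norm_num)
  have hu' : |u| ≤ 2 ^ n * ρ := hu.trans (by nlinarith)
  set G : ℕ → ℝ := fun j => if j = 0 then 0 else X' j t - X (j - 1) t with hG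
  have hch := pascal_of_chain (f := fun j => X' j t) (p := fun j => X j t) (q := G) (by simp [hG])
    i fun j _ => by simp [hG]
  have hGle : ∀ j ≤ i + 0, |G j| ≤ γ := fun j hj => by
    rcases Nat.eq_zero_or_pos j with rfl | hj0
    · simpa [hG] using hγ0
    · obtain ⟨m, rfl⟩ : ∃ m, j = m + 1 := ⟨j - 1, by omega⟩
      simpa [hG] using (h1 m (by omega) _ hu' fun k hk => hX k (by omega)).trans hγ
  have h3 := abs_pascal_le i 0 hGle
  have h4 : (2 : ℝ) ^ i * γ ≤ 2 ^ n * γ := by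
    have : (2 : ℝ) ^ i ≤ 2 ^ n := pow_le_pow_right₀ (by norm_num) hi
    gcongr
  rw [hch, h0]
  unfold pascalCoord
  rw [add_sub_cancel_left]
  exact h3.trans h4

theorem IntegratorChain.abs_pascalCoord_sub_le {n : ℕ} {Γ : ℝ → ℝ} {X X' : ℕ → ℝ → ℝ} {a b u ρ γ : ℝ}
    (h : IntegratorChain n Γ X X' a b u) (hρ : 0 ≤ ρ) (hu : |u| ≤ ρ) (hγ : Γ (2 ^ n * ρ) ≤ γ)
    (hγ0 : 0 ≤ γ) {i : ℕ} (hi : i ≤ n)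
    (hY : ∀ j < i, ∀ t ∈ Icc a b, |pascalCoord X j t| ≤ ρ) {j : ℕ} (hj : j ≤ i) {t : ℝ}
    (ht : t ∈ Icc a b) :
    |pascalCoord X j t - pascalCoord X j a| ≤ (t - a) * ((n + 1) * ρ + 2 ^ n * γ) := by
  have hc := h.mono ht
  have hY' : ∀ k < j, ∀ s ∈ Icc a t, |pascalCoord X k s| ≤ ρ :=
    fun k hk s hs => hY k (by omega) s ⟨hs.1, hs.2.trans ht.2⟩
  have h1 := hc.abs_deriv_pascal_sub_le hρ hu hγ hγ0 (hj.trans hi) hY'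
  have h2 := abs_increment_sub_le (F := pascalCoord X j) (c := 0) (e := (n + 1) * ρ + 2 ^ n * γ) ht.1
    (pascal_intervalIntegrable hc.integrable j 0)
    (pascal_eq_integral hc.integrable (fun m => hc.eq_integral m t ⟨ht.1, le_rfl⟩) j 0) (by
      filter_upwards [h1] with s hs hsI
      have hsum : |∑ k ∈ Finset.range j, pascalCoord X k s| ≤ n * ρ := by
        refine (Finset.abs_sum_le_sum_abs _ _).trans ?_
        refine (Finset.sum_le_card_nsmul _ _ ρ fun k hk =>
          hY' k (Finset.mem_range.1 hk) s (Ico_subset_Icc_self hsI)).trans ?_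
        rw [Finset.card_range, nsmul_eq_mul]
        have : (j : ℝ) ≤ n := by exact_mod_cast hj.trans hi
        gcongr
      have := hs hsI
      rw [abs_le] at this hsum hu ⊢
      constructor <;> linarith [this.1, this.2, hsum.1, hsum.2, hu.1, hu.2])
  simpa using h2

/-- Over one sampling interval a forwarding coordinate follows an Euler step up to a small error. -/
theorem IntegratorChain.abs_pascalCoord_euler_le {n : ℕ} {Γ : ℝ → ℝ} {X X' : ℕ → ℝ → ℝ}
    {a b u ρ γ r e : ℝ}
    (h : IntegratorChain n Γ X X' a b u) (hρ : 0 ≤ ρ) (hu : |u| ≤ ρ) (hγ : Γ (2 ^ n * ρ) ≤ γ)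
    (hγ0 : 0 ≤ γ) (hr : b - a ≤ r) (he : 2 ^ n * γ + n * (r * ((n + 1) * ρ + 2 ^ n * γ)) ≤ e)
    {i : ℕ} (hi : i ≤ n)
    (hY : ∀ j < i, ∀ t ∈ Icc a b, |pascalCoord X j t| ≤ ρ) {t : ℝ} (ht : t ∈ Icc a b) :
    |pascalCoord X i t - pascalCoord X i a
      - (t - a) * (u + ∑ j ∈ Finset.range i, pascalCoord X j a)| ≤ (t - a) * e := by
  have hc := h.mono ht
  have hY' : ∀ k < i, ∀ s ∈ Icc a t, |pascalCoord X k s| ≤ ρ :=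
    fun k hk s hs => hY k hk s ⟨hs.1, hs.2.trans ht.2⟩
  have h1 := hc.abs_deriv_pascal_sub_le hρ hu hγ hγ0 hi hY'
  refine abs_increment_sub_le (F := pascalCoord X i) ht.1
    (pascal_intervalIntegrable hc.integrable i 0)
    (pascal_eq_integral hc.integrable (fun m => hc.eq_integral m t ⟨ht.1, le_rfl⟩) i 0) ?_
  filter_upwards [h1] with s hs hsI
  have hB : 0 ≤ (n + 1) * ρ + 2 ^ n * γ := by positivity
  have hsum : |∑ k ∈ Finset.range i, (pascalCoord X k s - pascalCoord X k a)|
      ≤ n * (r * ((n + 1) * ρ + 2 ^ n * γ)) := by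
    refine (Finset.abs_sum_le_sum_abs _ _).trans ?_
    refine (Finset.sum_le_card_nsmul _ _ (r * ((n + 1) * ρ + 2 ^ n * γ)) fun k hk => ?_).trans ?_
    · refine (hc.abs_pascalCoord_sub_le hρ hu hγ hγ0 hi hY' (Finset.mem_range.1 hk).le
        (Ico_subset_Icc_self hsI)).trans ?_
      have := hsI.2.le.trans ht.2
      exact mul_le_mul_of_nonneg_right (by linarith) hB
    · rw [Finset.card_range, nsmul_eq_mul]
      have : (i : ℝ) ≤ n := by exact_mod_cast hi
      have hr0 : 0 ≤ r := by linarith [ht.1, ht.2]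
      gcongr
  rw [Finset.sum_sub_distrib] at hsum
  have := hs hsI
  rw [abs_le] at this hsum ⊢
  constructor <;> linarith [this.1, this.2, hsum.1, hsum.2]

/-- A trajectory of the sampled-data closed loop, coordinates being indexed by `ℕ`. -/
def IsTraj (n : ℕ) (Γ : ℝ → ℝ) (μ r : ℝ) (τ : ℕ → ℝ) (X : ℕ → ℝ → ℝ) : Prop :=
  Sched r τ ∧ ∃ X' : ℕ → ℝ → ℝ, ∀ k, IntegratorChain n Γ X X' (τ k) (τ (k + 1))
    (-nestedSat μ (fun i => pascalCoord X i (τ k)) (n + 1) 0)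

theorem IsTraj.growth {n : ℕ} {Γ : ℝ → ℝ} {μ r : ℝ} (hμ : 0 ≤ μ) (R T : ℝ) :
    ∃ M, 0 ≤ M ∧ ∀ τ X, IsTraj n Γ μ r τ X → (∀ j ≤ n, |X j 0| ≤ R) →
      ∀ j ≤ n, ∀ t ∈ Icc 0 T, |X j t| ≤ M := by
  suffices H : ∀ i, i ≤ n + 1 → ∃ M, μ ≤ M ∧ ∀ τ X, IsTraj n Γ μ r τ X →
      (∀ j ≤ n, |X j 0| ≤ R) → ∀ j < i, ∀ t ∈ Icc 0 T, |X j t| ≤ M by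
    obtain ⟨M, hM, h⟩ := H (n + 1) le_rfl
    exact ⟨M, hμ.trans hM, fun τ X hX h0 j hj => h τ X hX h0 j (by omega)⟩
  intro i hi
  induction i with
  | zero => exact ⟨μ, le_rfl, fun _ _ _ _ j hj => absurd hj (by omega)⟩
  | succ i ih =>
    obtain ⟨M, hM, h⟩ := ih (by omega)
    have hM0 : 0 ≤ M := hμ.trans hM
    set B := M + |Γ M| with hB
    have hB0 : 0 ≤ B := by positivity
    refine ⟨max M (R + T * B), hM.trans (le_max_left _ _), fun τ X hX h0 j hj t ht => ?_⟩
    rcases Nat.lt_succ_iff_lt_or_eq.1 hj with hj | rfl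
    · exact (h τ X hX h0 j hj t ht).trans (le_max_left _ _)
    refine le_max_of_le_right ?_
    have hlow := h τ X hX h0
    obtain ⟨hS, X', hch⟩ := hX
    have hS0 := hS.1
    suffices key : t ≤ T → |X j t| ≤ R + t * B by
      refine (key ht.2).trans ?_
      have := mul_le_mul_of_nonneg_right ht.2 hB0
      linarith
    refine hS.induction (Q := fun t => t ≤ T → |X j t| ≤ R + t * B) (N := 0) ?_ ?_
      (by rw [hS0]; exact ht.1)
    · intro _
      rw [hS0]
      simpa using h0 j (by omega)
    · intro k _ hk s hs hsT
      have hτk : 0 ≤ τ k := by rw [← hS0]; exact hS.strictMono.monotone (Nat.zero_le k)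
      have hk' := hk (hs.1.trans hsT)
      have hc := (hch k).mono hs
      have hu := abs_nestedSat_le hμ (fun i => pascalCoord X i (τ k)) (n + 1) 0
      rw [pow_zero, div_one, ← abs_neg] at hu
      have h1 := abs_increment_sub_le (F := X j) (c := 0) (e := B) hs.1 (hc.integrable j)
        (hc.eq_integral j s ⟨hs.1, le_rfl⟩) (by
          filter_upwards [hc.deriv_ae] with v hv hvI
          obtain ⟨hv0, hv1⟩ := hv hvI
          have hvT : v ∈ Icc 0 T := ⟨hτk.trans hvI.1, hvI.2.le.trans hsT⟩
          rcases Nat.eq_zero_or_pos j with rfl | hj0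
          · rw [hv0, sub_zero]
            have := abs_nonneg (Γ M)
            linarith
          · obtain ⟨m, rfl⟩ : ∃ m, j = m + 1 := ⟨j - 1, by omega⟩
            have h2 := hv1 m (by omega) M (hu.trans hM) fun q hq => hlow q (by omega) v hvT
            have h3 := hlow m (by omega) v hvT
            have h4 := le_abs_self (Γ M)
            rw [abs_le] at h2 h3 ⊢
            constructor <;> linarith [h2.1, h2.2, h3.1, h3.2])
      have h2 := abs_sub_abs_le_abs_sub (X j s) (X j (τ k))
      simp only [mul_zero, sub_zero] at h1
      linarith

theorem five_eighths_div_four_pow_le {ρ : ℝ} (hρ : 0 ≤ ρ) (j : ℕ) : 5 / 8 * (ρ / 4 ^ j) ≤ ρ := by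
  have : ρ / 4 ^ j ≤ ρ := div_le_self hρ (one_le_pow₀ (by norm_num))
  linarith

/-- Standing smallness conditions on the saturation level `μ` and the sampling period `r`. -/
structure SmallGain (n : ℕ) (Γ : ℝ → ℝ) (C μ r : ℝ) : Prop where
  level_pos : 0 < μ
  gain_nonneg : 0 ≤ C
  period_pos : 0 < r
  period_le : r ≤ 1 / 10
  quadratic : ∀ ρ, 0 ≤ ρ → ρ ≤ μ → Γ (2 ^ n * ρ) ≤ C * ρ ^ 2
  error_le : ∀ ρ, 0 ≤ ρ → ρ ≤ μ →
    2 ^ n * (C * ρ ^ 2) + n * (r * ((n + 1) * ρ + 2 ^ n * (C * ρ ^ 2))) ≤ ρ / 4 ^ n / 8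

theorem IsTraj.abs_euler_step_le {n : ℕ} {Γ : ℝ → ℝ} {C μ r ρ : ℝ} {τ : ℕ → ℝ} {X : ℕ → ℝ → ℝ}
    (hG : SmallGain n Γ C μ r) (hX : IsTraj n Γ μ r τ X) (hρ : 0 ≤ ρ) (hρμ : ρ ≤ μ) {k i : ℕ}
    (hi : i ≤ n) (hu : |nestedSat μ (fun i => pascalCoord X i (τ k)) (n + 1) 0| ≤ ρ)
    (hY : ∀ j < i, ∀ t ∈ Icc (τ k) (τ (k + 1)), |pascalCoord X j t| ≤ 5 / 8 * (ρ / 4 ^ j))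
    {t : ℝ} (ht : t ∈ Icc (τ k) (τ (k + 1))) :
    |pascalCoord X i t - pascalCoord X i (τ k) - (t - τ k) *
      -clamp (μ / 4 ^ i) (pascalCoord X i (τ k)
        + nestedSat μ (fun i => pascalCoord X i (τ k)) (n - i) (i + 1))|
      ≤ (t - τ k) * (ρ / 4 ^ i / 8) := by
  obtain ⟨hS, X', hch⟩ := hX
  have h1 := (hch k).abs_pascalCoord_euler_le hρ (by rwa [abs_neg]) (hG.quadratic ρ hρ hρμ)
    (mul_nonneg hG.gain_nonneg (sq_nonneg ρ)) (hS.2.2.1 k) (hG.error_le ρ hρ hρμ) hi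
    (fun j hj s hs => (hY j hj s hs).trans (five_eighths_div_four_pow_le hρ j)) ht
  have h2 := nestedSat_eq_sum_add hG.level_pos.le (y := fun i => pascalCoord X i (τ k)) i
    (n - i + 1) fun j hj => (hY j hj (τ k) ⟨le_rfl, ht.1.trans ht.2⟩).trans (by gcongr)
  rw [show n - i + 1 + i = n + 1 by omega] at h2
  rw [h2, nestedSat] at h1
  have h3 : ρ / 4 ^ n ≤ ρ / 4 ^ i :=
    div_le_div_of_nonneg_left hρ (by positivity) (pow_le_pow_right₀ (by norm_num) hi)
  have h4 : (t - τ k) * (ρ / 4 ^ n / 8) ≤ (t - τ k) * (ρ / 4 ^ i / 8) :=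
    mul_le_mul_of_nonneg_left (by linarith) (sub_nonneg.2 ht.1)
  refine le_trans (le_of_eq ?_) (h1.trans h4)
  congr 1
  ring

theorem IsTraj.eventually_unsaturated {n : ℕ} {Γ : ℝ → ℝ} {C μ r : ℝ}
    (hG : SmallGain n Γ C μ r) (R : ℝ) : ∃ T, 0 ≤ T ∧ ∀ τ X, IsTraj n Γ μ r τ X →
      (∀ j ≤ n, |X j 0| ≤ R) → ∀ j ≤ n, ∀ t, T ≤ t → |pascalCoord X j t| ≤ 5 / 8 * (μ / 4 ^ j) := by
  suffices H : ∀ i, i ≤ n + 1 → ∃ T, 0 ≤ T ∧ ∀ τ X, IsTraj n Γ μ r τ X →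
      (∀ j ≤ n, |X j 0| ≤ R) → ∀ j < i, ∀ t, T ≤ t →
      |pascalCoord X j t| ≤ 5 / 8 * (μ / 4 ^ j) by
    obtain ⟨T, hT, h⟩ := H (n + 1) le_rfl
    exact ⟨T, hT, fun τ X hX h0 j hj => h τ X hX h0 j (by omega)⟩
  have hμ := hG.level_pos
  have hr := hG.period_pos
  intro i hi
  induction i with
  | zero => exact ⟨0, le_rfl, fun _ _ _ _ j hj => absurd hj (by omega)⟩
  | succ i ih =>
    obtain ⟨T, hT, h⟩ := ih (by omega)
    obtain ⟨M, hM, hgrow⟩ := IsTraj.growth (n := n) (Γ := Γ) (r := r) hμ.le R (T + r)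
    set m := μ / 4 ^ i with hm
    have hm0 : 0 < m := by positivity
    have hA : 0 ≤ 2 ^ i * M / (m / 8) := by positivity
    refine ⟨T + r + 2 ^ i * M / (m / 8), by positivity, fun τ X hX h0 j hj t ht => ?_⟩
    rcases Nat.lt_succ_iff_lt_or_eq.1 hj with hj | rfl
    · exact h τ X hX h0 j hj t (by linarith)
    have hS := hX.1
    obtain ⟨N, hN1, hN2⟩ := hS.exists_mem hr.le hT
    have hYN : |pascalCoord X j (τ N)| ≤ 2 ^ j * M :=
      abs_pascal_le j 0 fun q hq => hgrow τ X hX h0 q (by omega) _ ⟨hT.trans hN1, hN2⟩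
    have key : |pascalCoord X j t|
        ≤ max (5 / 8 * m) (|pascalCoord X j (τ N)| - (t - τ N) * (m / 8)) := by
      refine hS.induction (Q := fun t => |pascalCoord X j t|
        ≤ max (5 / 8 * m) (|pascalCoord X j (τ N)| - (t - τ N) * (m / 8))) (N := N) ?_ ?_
        (by linarith)
      · simp
      · intro k hNk hk s hs
        have hτ := hS.strictMono.monotone hNk
        have hu := abs_nestedSat_le hμ.le (fun i => pascalCoord X i (τ k)) (n + 1) 0
        rw [pow_zero, div_one] at hu
        have h1 := hX.abs_euler_step_le hG hμ.le le_rfl (by omega) hu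
          (fun q hq v hv => h τ X hX h0 q hq v (hN1.trans (hτ.trans hv.1))) hs
        have hw := abs_nestedSat_le hμ.le (fun i => pascalCoord X i (τ k)) (n - j) (j + 1)
        rw [div_four_pow_succ] at hw
        have h2 := abs_le_max_of_clamp_step hm0 (sub_nonneg.2 hs.1)
          (by linarith [hS.2.2.1 k, hs.2, hG.period_le]) hw h1
        refine h2.trans (max_le (le_max_left _ _) ?_)
        have hnn : 0 ≤ (s - τ k) * (m / 8) := mul_nonneg (sub_nonneg.2 hs.1) (by positivity)
        rcases le_max_iff.1 hk with hk | hk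
        · exact le_max_of_le_left (by linarith)
        · exact le_max_of_le_right (by linarith)
    refine key.trans (max_le le_rfl ?_)
    have h5 : 2 ^ j * M / (m / 8) * (m / 8) ≤ (t - τ N) * (m / 8) :=
      mul_le_mul_of_nonneg_right (by linarith) (by positivity)
    rw [div_mul_cancel₀ _ (by positivity)] at h5
    linarith

theorem IsTraj.local_step {n : ℕ} {Γ : ℝ → ℝ} {C μ r ρ : ℝ} {τ : ℕ → ℝ} {X : ℕ → ℝ → ℝ}
    (hG : SmallGain n Γ C μ r) (hX : IsTraj n Γ μ r τ X) (hρ : 0 ≤ ρ) (hρμ : ρ ≤ μ) {k : ℕ}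
    (h0 : ∀ j ≤ n, |pascalCoord X j (τ k)| ≤ 5 / 8 * (ρ / 4 ^ j)) :
    ∀ j ≤ n, ∀ t ∈ Icc (τ k) (τ (k + 1)),
      |pascalCoord X j t| ≤ 5 / 8 * (ρ / 4 ^ j) * (1 - 2 / 5 * (t - τ k)) := by
  have hsmall := fun q i (hqi : i + q ≤ n + 1) => abs_nestedSat_le_of_small hρ hρμ
    (y := fun i => pascalCoord X i (τ k)) q i fun j hj => h0 j (by omega)
  intro j
  induction j using Nat.strong_induction_on with
  | _ i ih =>
    intro hi t ht
    have hu := hsmall (n + 1) 0 (by omega)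
    rw [pow_zero, div_one] at hu
    have h1 := hX.abs_euler_step_le hG hρ hρμ hi hu (fun j hj s hs => by
      refine (ih j hj (by omega) s hs).trans ?_
      refine mul_le_of_le_one_right (by positivity) ?_
      linarith [hs.1]) ht
    have hw := hsmall (n - i) (i + 1) (by omega)
    have hy := h0 i hi
    rw [div_four_pow_succ] at hw
    set w := nestedSat μ (fun i => pascalCoord X i (τ k)) (n - i) (i + 1)
    set y := pascalCoord X i (τ k)
    have hm : 0 ≤ ρ / 4 ^ i := by positivity
    have hle : ρ / 4 ^ i ≤ μ / 4 ^ i := by gcongr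
    set m := ρ / 4 ^ i
    rw [clamp_of_abs_le ((abs_add_le _ _).trans (by linarith))] at h1
    have ht0 : 0 ≤ t - τ k := sub_nonneg.2 ht.1
    have ht1 : t - τ k ≤ 1 := by linarith [hX.1.2.2.1 k, ht.2, hG.period_le]
    set s := t - τ k
    have hA : |(1 - s) * y| ≤ (1 - s) * (5 / 8 * m) := by
      rw [abs_mul, abs_of_nonneg (by linarith : 0 ≤ 1 - s)]
      exact mul_le_mul_of_nonneg_left hy (by linarith)
    have hB : |s * w| ≤ s * (m / 4) := by
      rw [abs_mul, abs_of_nonneg ht0]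
      exact mul_le_mul_of_nonneg_left hw ht0
    rw [abs_le] at hA hB h1 ⊢
    constructor <;> linarith [hA.1, hA.2, hB.1, hB.2, h1.1, h1.2]

theorem IsTraj.exponential_decay {n : ℕ} {Γ : ℝ → ℝ} {C μ r ρ : ℝ} {τ : ℕ → ℝ}
    {X : ℕ → ℝ → ℝ} (hG : SmallGain n Γ C μ r) (hX : IsTraj n Γ μ r τ X) (hρ : 0 ≤ ρ)
    (hρμ : ρ ≤ μ) {N : ℕ} (h0 : ∀ j ≤ n, |pascalCoord X j (τ N)| ≤ 5 / 8 * (ρ / 4 ^ j))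
    {t : ℝ} (ht : τ N ≤ t) :
    ∀ j ≤ n, |X j t| ≤ 2 ^ n * (ρ * Real.exp (-(2 / 5 * (t - τ N)))) := by
  have key : ∀ j ≤ n, |pascalCoord X j t|
      ≤ 5 / 8 * (ρ * Real.exp (-(2 / 5 * (t - τ N))) / 4 ^ j) := by
    refine hX.1.induction (Q := fun t => ∀ j ≤ n, |pascalCoord X j t|
      ≤ 5 / 8 * (ρ * Real.exp (-(2 / 5 * (t - τ N))) / 4 ^ j)) (N := N) (by simpa using h0) ?_ ht
    intro k hNk hk s hs j hj
    have hτ : τ N ≤ τ k := hX.1.strictMono.monotone hNk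
    have hρ' : ρ * Real.exp (-(2 / 5 * (τ k - τ N))) ≤ ρ :=
      mul_le_of_le_one_right hρ (Real.exp_le_one_iff.2 (by linarith))
    refine (hX.local_step hG (by positivity) (hρ'.trans hρμ) hk j hj s hs).trans ?_
    have h1 : 1 - 2 / 5 * (s - τ k) ≤ Real.exp (-(2 / 5 * (s - τ k))) := by
      have := Real.add_one_le_exp (-(2 / 5 * (s - τ k)))
      linarith
    refine (mul_le_mul_of_nonneg_left h1 (by positivity)).trans (le_of_eq ?_)
    rw [show -(2 / 5 * (s - τ N)) = -(2 / 5 * (τ k - τ N)) + -(2 / 5 * (s - τ k)) by ring,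
      Real.exp_add]
    ring
  have hρ1 : 0 ≤ ρ * Real.exp (-(2 / 5 * (t - τ N))) := by positivity
  have := abs_le_of_pascalCoord (n := n) hρ1 le_rfl
    fun j hj => (key j (by omega)).trans (five_eighths_div_four_pow_le hρ1 j)
  exact fun j hj => this j (by omega)

theorem SmallGain.exists_of_quadratic {n : ℕ} {Γ : ℝ → ℝ} {C : ℝ} (hC : 0 ≤ C)
    (h : ∀ ρ, 0 ≤ ρ → ρ ≤ 1 → Γ (2 ^ n * ρ) ≤ C * ρ ^ 2) : ∃ μ r, SmallGain n Γ C μ r := by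
  set D : ℝ := 2 ^ n * C + 1 with hD
  have hD0 : 0 < D := by positivity
  set μ : ℝ := min 1 (1 / (16 * 4 ^ n * D)) with hμ
  set r : ℝ := min (1 / 10) (1 / (16 * 4 ^ n * ((n + 1) * (n + 1 + D)))) with hr
  have hμ0 : 0 < μ := lt_min one_pos (by positivity)
  have hr0 : 0 < r := lt_min (by norm_num) (by positivity)
  refine ⟨μ, r, hμ0, hC, hr0, min_le_left _ _,
    fun ρ h0 h1 => h ρ h0 (h1.trans (min_le_left _ _)), fun ρ h0 h1 => ?_⟩
  have hρ1 : ρ ≤ 1 := h1.trans (min_le_left _ _)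
  have hDρ : D * ρ ≤ 1 / (16 * 4 ^ n) := by
    have := mul_le_mul_of_nonneg_left (h1.trans (min_le_right _ _)) hD0.le
    refine this.trans (le_of_eq ?_)
    field_simp
  have hrD : (n + 1) * (n + 1 + D) * r ≤ 1 / (16 * 4 ^ n) := by
    have := mul_le_mul_of_nonneg_left (min_le_right (1 / 10 : ℝ)
      (1 / (16 * 4 ^ n * ((n + 1) * (n + 1 + D))))) (by positivity : 0 ≤ (n + 1) * (n + 1 + D))
    refine this.trans (le_of_eq ?_)
    field_simp
  have e1 : 2 ^ n * (C * ρ ^ 2) ≤ D * ρ * ρ := by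
    rw [hD]; nlinarith [sq_nonneg ρ]
  have e2 : D * ρ * ρ ≤ 1 / (16 * 4 ^ n) * ρ := mul_le_mul_of_nonneg_right hDρ h0
  have e3 : (n + 1) * ρ + 2 ^ n * (C * ρ ^ 2) ≤ (n + 1 + D) * ρ := by
    have : D * ρ * ρ ≤ D * ρ := mul_le_of_le_one_right (by positivity) hρ1
    linarith
  have e4 : n * (r * ((n + 1) * ρ + 2 ^ n * (C * ρ ^ 2))) ≤ (n + 1) * (r * ((n + 1 + D) * ρ)) := by
    gcongr
    linarith
  have e5 : (n + 1) * (r * ((n + 1 + D) * ρ)) ≤ 1 / (16 * 4 ^ n) * ρ := by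
    have := mul_le_mul_of_nonneg_right hrD h0
    linarith
  have e6 : ρ / 4 ^ n / 8 = 1 / (16 * 4 ^ n) * ρ + 1 / (16 * 4 ^ n) * ρ := by
    field_simp
    ring
  linarith

/-- The coordinates of a Euclidean vector, extended by zero to all of `ℕ`. -/
def natCoord {n : ℕ} (x : EuclideanSpace ℝ (Fin (n + 1))) (j : ℕ) : ℝ :=
  if h : j < n + 1 then x ⟨j, h⟩ else 0

theorem natCoord_val {n : ℕ} (x : EuclideanSpace ℝ (Fin (n + 1))) (i : Fin (n + 1)) :
    natCoord x i = x i := dif_pos i.isLt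

theorem abs_natCoord_le {n : ℕ} (x : EuclideanSpace ℝ (Fin (n + 1))) (j : ℕ) :
    |natCoord x j| ≤ ‖x‖ := by
  unfold natCoord
  split_ifs with h
  · exact PiLp.norm_apply_le x ⟨j, h⟩
  · simp

theorem natCoord_zero {n : ℕ} : natCoord (0 : EuclideanSpace ℝ (Fin (n + 1))) = fun _ => 0 := by
  funext j
  simp [natCoord]

theorem continuous_natCoord {n : ℕ} (j : ℕ) :
    Continuous fun x : EuclideanSpace ℝ (Fin (n + 1)) => natCoord x j := by
  unfold natCoord
  split_ifs with h
  · exact (EuclideanSpace.proj (𝕜 := ℝ) (⟨j, h⟩ : Fin (n + 1))).continuous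
  · exact continuous_const

theorem norm_le_of_abs_apply_le {n : ℕ} {x : EuclideanSpace ℝ (Fin (n + 1))} {M : ℝ} (hM : 0 ≤ M)
    (h : ∀ i, |x i| ≤ M) : ‖x‖ ≤ (n + 1) * M := by
  rw [EuclideanSpace.norm_eq]
  refine Real.sqrt_le_iff.2 ⟨by positivity, ?_⟩
  have h1 : ∑ i, ‖x i‖ ^ 2 ≤ ∑ _i : Fin (n + 1), M ^ 2 := Finset.sum_le_sum fun i _ => by
    rw [Real.norm_eq_abs]
    exact pow_le_pow_left₀ (abs_nonneg _) (h i) 2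
  rw [Finset.sum_const, Finset.card_univ, Fintype.card_fin, nsmul_eq_mul] at h1
  push_cast at h1
  have hn : (0 : ℝ) ≤ n := Nat.cast_nonneg n
  have : (0 : ℝ) ≤ ((n + 1) * n) * M ^ 2 := by positivity
  nlinarith

theorem norm_le_of_abs_natCoord_le {n : ℕ} {x : EuclideanSpace ℝ (Fin (n + 1))} {M : ℝ}
    (hM : 0 ≤ M) (h : ∀ j ≤ n, |natCoord x j| ≤ M) : ‖x‖ ≤ (n + 1) * M :=
  norm_le_of_abs_apply_le hM fun i => by
    simpa only [natCoord_val] using h i (Nat.lt_succ_iff.1 i.isLt)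

theorem natCoord_intervalIntegrable {n : ℕ} {F : ℝ → EuclideanSpace ℝ (Fin (n + 1))} {a b : ℝ}
    (h : IntervalIntegrable F volume a b) (j : ℕ) :
    IntervalIntegrable (fun s => natCoord (F s) j) volume a b := by
  unfold natCoord
  split_ifs with hj
  · exact ⟨(EuclideanSpace.proj (𝕜 := ℝ) (⟨j, hj⟩ : Fin (n + 1))).integrable_comp h.1,
      (EuclideanSpace.proj (𝕜 := ℝ) (⟨j, hj⟩ : Fin (n + 1))).integrable_comp h.2⟩
  · exact intervalIntegrable_const

theorem natCoord_integral {n : ℕ} {F : ℝ → EuclideanSpace ℝ (Fin (n + 1))} {a b : ℝ}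
    (h : IntervalIntegrable F volume a b) (j : ℕ) :
    natCoord (∫ s in a..b, F s) j = ∫ s in a..b, natCoord (F s) j := by
  unfold natCoord
  split_ifs with hj
  · exact ((EuclideanSpace.proj (𝕜 := ℝ)
      (⟨j, hj⟩ : Fin (n + 1))).intervalIntegral_comp_comm h).symm
  · simp

theorem natCoord_add {n : ℕ} (x y : EuclideanSpace ℝ (Fin (n + 1))) (j : ℕ) :
    natCoord (x + y) j = natCoord x j + natCoord y j := by
  unfold natCoord
  split_ifs <;> simp

/-- The nested saturation feedback in the original coordinates. -/
def nestedFeedback {n : ℕ} (μ : ℝ) (x : EuclideanSpace ℝ (Fin (n + 1))) : ℝ :=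
  -nestedSat μ (fun i => pascal (natCoord x) i 0) (n + 1) 0

theorem nestedFeedback_zero {n : ℕ} {μ : ℝ} (hμ : 0 ≤ μ) :
    nestedFeedback μ (0 : EuclideanSpace ℝ (Fin (n + 1))) = 0 := by
  have h := abs_nestedSat_le_of_small le_rfl hμ
    (y := fun i => pascal (natCoord (0 : EuclideanSpace ℝ (Fin (n + 1)))) i 0) (n + 1) 0
    fun j _ => by simp [natCoord_zero, pascal_zero]
  rw [zero_div] at h
  rw [nestedFeedback, abs_nonpos_iff.1 h, neg_zero]

theorem continuous_nestedFeedback {n : ℕ} (μ : ℝ) :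
    Continuous (nestedFeedback μ : EuclideanSpace ℝ (Fin (n + 1)) → ℝ) :=
  (continuous_nestedSat μ (fun j => continuous_pascal continuous_natCoord j 0) _ _).neg

theorem abs_nestedFeedback_le {n : ℕ} {μ : ℝ} (hμ : 0 ≤ μ)
    (x : EuclideanSpace ℝ (Fin (n + 1))) : |nestedFeedback μ x| ≤ μ := by
  have := abs_nestedSat_le hμ (fun i => pascal (natCoord x) i 0) (n + 1) 0
  rw [pow_zero, div_one] at this
  rwa [nestedFeedback, abs_neg]

theorem abs_le_of_feedforward_growth {n : ℕ} {G : EuclideanSpace ℝ (Fin (n + 1)) → ℝ → ℝ}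
    {L : ℝ → ℝ} (hL : MonotoneOn L (Ici 0)) (hL0 : ∀ s, 0 ≤ s → 0 ≤ L s) {j : ℕ}
    (hG : ∀ x u, |G x u| ≤ L (Real.sqrt (‖truncV j x‖ ^ 2 + u ^ 2)) * ‖truncV j x‖ ^ 2
      + L (Real.sqrt (‖truncV j x‖ ^ 2 + u ^ 2)) * ‖truncV j x‖ * |u|)
    {x : EuclideanSpace ℝ (Fin (n + 1))} {u M : ℝ} (hu : |u| ≤ M)
    (hx : ∀ m < j, |natCoord x m| ≤ M) :
    |G x u| ≤ L (2 * ((n + 1) * M)) * (2 * ((n + 1) * M) ^ 2) := by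
  have hM : 0 ≤ M := (abs_nonneg u).trans hu
  have ht : ‖truncV j x‖ ≤ (n + 1) * M := norm_le_of_abs_apply_le hM fun i => by
    have : truncV j x i = if (i : ℕ) < j then x i else 0 := rfl
    rw [this]
    split_ifs with h
    · simpa only [natCoord_val] using hx i h
    · simpa using hM
  set K := (n + 1) * M with hK
  have hK0 : 0 ≤ K := by positivity
  have hu' : |u| ≤ K := hu.trans (by
    have : (0 : ℝ) ≤ n * M := by positivity
    linarith)
  set v := ‖truncV j x‖
  have hv : 0 ≤ v := norm_nonneg _
  have hs : Real.sqrt (v ^ 2 + u ^ 2) ≤ 2 * K := by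
    refine Real.sqrt_le_iff.2 ⟨by positivity, ?_⟩
    have h1 : v ^ 2 ≤ K ^ 2 := pow_le_pow_left₀ hv ht 2
    have h2 : u ^ 2 ≤ K ^ 2 := by rw [← sq_abs u]; exact pow_le_pow_left₀ (abs_nonneg u) hu' 2
    nlinarith [sq_nonneg K]
  have hLs := hL (Real.sqrt_nonneg _) (show (0 : ℝ) ≤ 2 * K by positivity) hs
  have hLs0 := hL0 _ (Real.sqrt_nonneg (v ^ 2 + u ^ 2))
  have hL2 := hLs0.trans hLs
  calc |G x u| ≤ _ := hG x u
    _ ≤ L (2 * K) * K ^ 2 + L (2 * K) * K * K := by gcongr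
    _ = _ := by ring

theorem FFSol.isTraj {n l : ℕ} {D : Set (EuclideanSpace ℝ (Fin l))}
    {g : Fin (n + 1) → EuclideanSpace ℝ (Fin l) → EuclideanSpace ℝ (Fin (n + 1)) → ℝ → ℝ}
    {L : ℝ → ℝ} (hL : MonotoneOn L (Ici 0)) (hL0 : ∀ s, 0 ≤ s → 0 ≤ L s)
    (hgrowth : ∀ j : Fin (n + 1), (j : ℕ) ≠ 0 → ∀ d ∈ D,
      ∀ x : EuclideanSpace ℝ (Fin (n + 1)), ∀ u : ℝ,
      |g j d x u| ≤
        L (Real.sqrt (‖truncV (j : ℕ) x‖ ^ 2 + u ^ 2)) * ‖truncV (j : ℕ) x‖ ^ 2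
          + L (Real.sqrt (‖truncV (j : ℕ) x‖ ^ 2 + u ^ 2)) * ‖truncV (j : ℕ) x‖ * |u|)
    {μ r : ℝ} {τ : ℕ → ℝ} {d : ℝ → EuclideanSpace ℝ (Fin l)}
    {x : ℝ → EuclideanSpace ℝ (Fin (n + 1))} (hS : Sched r τ) (hd : ∀ t, d t ∈ D)
    (hx : FFSol g (nestedFeedback μ) τ d x) :
    IsTraj n (fun M => L (2 * ((n + 1) * M)) * (2 * ((n + 1) * M) ^ 2)) μ r τ
      (fun j t => natCoord (x t) j) := by
  obtain ⟨x', hint, heq, hae⟩ := hx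
  have hint' : ∀ a b, IntervalIntegrable x' volume a b := fun a b => (hint a).symm.trans (hint b)
  refine ⟨hS, fun j t => natCoord (x' t) j, fun k => ⟨?_, ?_, ?_⟩⟩
  · exact fun j => natCoord_intervalIntegrable (hint' _ _) j
  · intro j t ht
    have hτ : 0 ≤ τ k := by rw [← hS.1]; exact hS.strictMono.monotone (Nat.zero_le k)
    have h1 : x t = x (τ k) + ∫ s in (τ k)..t, x' s := by
      rw [heq t (hτ.trans ht.1), heq (τ k) hτ,
        ← intervalIntegral.integral_add_adjacent_intervals (hint' 0 (τ k)) (hint' (τ k) t),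
        add_assoc]
    show natCoord (x t) j = natCoord (x (τ k)) j + _
    rw [← natCoord_integral (hint' _ _), ← natCoord_add, ← h1]
  · have h1 := (ae_restrict_iff' measurableSet_Ico).1 (hae k)
    filter_upwards [h1] with t ht htI
    obtain ⟨h0, hj⟩ := ht htI
    refine ⟨(natCoord_val (x' t) 0).trans h0, fun j hjn M hu hM => ?_⟩
    have h2 := hj ⟨j + 1, by omega⟩ (by simp)
    have h3 : natCoord (x' t) (j + 1) - natCoord (x t) j
        = g ⟨j + 1, by omega⟩ (d t) (x t) (nestedFeedback μ (x (τ k))) := by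
      simp only [natCoord, dif_pos (show j + 1 < n + 1 by omega),
        dif_pos (show j < n + 1 by omega), h2]
      simp
    rw [h3]
    exact abs_le_of_feedforward_growth hL hL0 (hgrowth ⟨j + 1, by omega⟩ (by simp) (d t) (hd t))
      hu fun m hm => hM m (Nat.lt_succ_iff.1 hm)

/-- **Theorem 3.7 (existence part).** For the uncertain feedforward system (1.1) under the
growth assumption (1.2), there exist a bounded feedback `k` with `k(0)=0`, continuous at `0`,
and a MASP `r > 0`, such that `0` is RGAS (P1, P2, P3) for the closed-loop sampled-data
system. -/
theorem theorem_3_7_existence (n l : ℕ)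
    (D : Set (EuclideanSpace ℝ (Fin l))) (hD : D.Nonempty) (hDc : IsCompact D)
    (g : Fin (n+1) → EuclideanSpace ℝ (Fin l) → EuclideanSpace ℝ (Fin (n+1)) → ℝ → ℝ)
    (hgLip : ∀ j : Fin (n+1), LocallyLipschitz
      (fun q : EuclideanSpace ℝ (Fin l) × EuclideanSpace ℝ (Fin (n+1)) × ℝ =>
        g j q.1 q.2.1 q.2.2))
    (hdep : ∀ j : Fin (n+1), ∀ d : EuclideanSpace ℝ (Fin l),
      ∀ x₁ x₂ : EuclideanSpace ℝ (Fin (n+1)), ∀ u : ℝ,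
      (∀ m : Fin (n+1), (m : ℕ) < (j : ℕ) → x₁ m = x₂ m) → g j d x₁ u = g j d x₂ u)
    (L : ℝ → ℝ) (hLsmooth : ContDiff ℝ (⊤ : ℕ∞) L) (hLmono : MonotoneOn L (Ici 0))
    (hLnn : ∀ s : ℝ, 0 ≤ s → 0 ≤ L s)
    (hgrowth : ∀ j : Fin (n+1), (j : ℕ) ≠ 0 → ∀ d ∈ D,
      ∀ x : EuclideanSpace ℝ (Fin (n+1)), ∀ u : ℝ,
      |g j d x u| ≤
        L (Real.sqrt (‖truncV (j : ℕ) x‖ ^ 2 + u ^ 2)) * ‖truncV (j : ℕ) x‖ ^ 2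
          + L (Real.sqrt (‖truncV (j : ℕ) x‖ ^ 2 + u ^ 2)) * ‖truncV (j : ℕ) x‖ * |u|) :
    ∃ (k : EuclideanSpace ℝ (Fin (n+1)) → ℝ) (r : ℝ), 0 < r ∧
      (∃ C : ℝ, ∀ x : EuclideanSpace ℝ (Fin (n+1)), |k x| ≤ C) ∧
      k 0 = 0 ∧ ContinuousAt k 0 ∧
      -- P1: Robust Lagrange Stability
      (∀ ε : ℝ, 0 < ε → ∃ C : ℝ,
        ∀ (τ : ℕ → ℝ) (d : ℝ → EuclideanSpace ℝ (Fin l))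
          (x : ℝ → EuclideanSpace ℝ (Fin (n+1))),
          Sched r τ → Measurable d → (∀ t : ℝ, d t ∈ D) → FFSol g k τ d x →
          ‖x 0‖ ≤ ε → ∀ t : ℝ, 0 ≤ t → ‖x t‖ ≤ C) ∧
      -- P2: Robust Lyapunov Stability
      (∀ ε : ℝ, 0 < ε → ∃ δ0 : ℝ, 0 < δ0 ∧
        ∀ (τ : ℕ → ℝ) (d : ℝ → EuclideanSpace ℝ (Fin l))
          (x : ℝ → EuclideanSpace ℝ (Fin (n+1))),
          Sched r τ → Measurable d → (∀ t : ℝ, d t ∈ D) → FFSol g k τ d x →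
          ‖x 0‖ ≤ δ0 → ∀ t : ℝ, 0 ≤ t → ‖x t‖ ≤ ε) ∧
      -- P3: Robust Attractivity
      (∀ ε R0 : ℝ, 0 < ε → 0 ≤ R0 → ∃ T : ℝ, 0 ≤ T ∧
        ∀ (τ : ℕ → ℝ) (d : ℝ → EuclideanSpace ℝ (Fin l))
          (x : ℝ → EuclideanSpace ℝ (Fin (n+1))),
          Sched r τ → Measurable d → (∀ t : ℝ, d t ∈ D) → FFSol g k τ d x →
          ‖x 0‖ ≤ R0 → ∀ t : ℝ, T ≤ t → ‖x t‖ ≤ ε) := by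
  have hquad : ∀ ρ : ℝ, 0 ≤ ρ → ρ ≤ 1 →
      L (2 * ((n + 1) * (2 ^ n * ρ))) * (2 * ((n + 1) * (2 ^ n * ρ)) ^ 2)
        ≤ L (2 * ((n + 1) * 2 ^ n)) * (2 * ((n + 1) * 2 ^ n) ^ 2) * ρ ^ 2 := by
    intro ρ h0 h1
    have h2 : L (2 * ((n + 1) * (2 ^ n * ρ))) ≤ L (2 * ((n + 1) * 2 ^ n)) := by
      refine hLmono (show (0 : ℝ) ≤ _ by positivity) (show (0 : ℝ) ≤ _ by positivity) ?_
      have : (2 : ℝ) ^ n * ρ ≤ 2 ^ n := mul_le_of_le_one_right (by positivity) h1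
      gcongr
    refine (mul_le_mul_of_nonneg_right h2 (by positivity)).trans (le_of_eq ?_)
    ring
  obtain ⟨μ, r, hG⟩ := SmallGain.exists_of_quadratic
    (n := n) (Γ := fun M => L (2 * ((n + 1) * M)) * (2 * ((n + 1) * M) ^ 2))
    (mul_nonneg (hLnn (2 * ((n + 1) * 2 ^ n)) (by positivity)) (by positivity)) hquad
  have hμ := hG.level_pos
  have htraj := fun (τ : ℕ → ℝ) (d : ℝ → EuclideanSpace ℝ (Fin l))
    (x : ℝ → EuclideanSpace ℝ (Fin (n+1))) (hS : Sched r τ) (hd : ∀ t : ℝ, d t ∈ D)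
    (hx : FFSol g (nestedFeedback μ) τ d x) => FFSol.isTraj hLmono hLnn hgrowth hS hd hx
  have hlate : ∀ R : ℝ, ∃ T, 0 ≤ T ∧ ∀ (τ : ℕ → ℝ) (d : ℝ → EuclideanSpace ℝ (Fin l))
      (x : ℝ → EuclideanSpace ℝ (Fin (n+1))), Sched r τ → (∀ t : ℝ, d t ∈ D) →
      FFSol g (nestedFeedback μ) τ d x → ‖x 0‖ ≤ R → ∀ t, T ≤ t →
      ‖x t‖ ≤ (n + 1) * (2 ^ n * (μ * Real.exp (-(2 / 5 * (t - T))))) := by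
    intro R
    obtain ⟨T, hT, h⟩ := IsTraj.eventually_unsaturated hG R
    refine ⟨T + r, by linarith [hG.period_pos], fun τ d x hS hd hx h0 t ht => ?_⟩
    have hX := htraj τ d x hS hd hx
    obtain ⟨N, hN1, hN2⟩ := hS.exists_mem hG.period_pos.le hT
    have h1 := hX.exponential_decay hG hμ.le le_rfl (N := N)
      (fun j hj => h τ _ hX (fun i _ => (abs_natCoord_le _ _).trans h0) j hj _ hN1)
      (hN2.trans ht)
    refine norm_le_of_abs_natCoord_le (by positivity) fun j hj => (h1 j hj).trans ?_
    gcongr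
  refine ⟨nestedFeedback μ, r, hG.period_pos, ⟨μ, abs_nestedFeedback_le hμ.le⟩,
    nestedFeedback_zero hμ.le, (continuous_nestedFeedback μ).continuousAt, ?_, ?_, ?_⟩
  · intro ε _
    obtain ⟨T, hT, h⟩ := hlate ε
    obtain ⟨M, hM, hgrow⟩ := IsTraj.growth (n := n) (r := r)
      (Γ := fun M => L (2 * ((n + 1) * M)) * (2 * ((n + 1) * M) ^ 2)) hμ.le ε T
    refine ⟨max ((n + 1) * M) ((n + 1) * (2 ^ n * μ)), fun τ d x hS _ hd hx h0 t ht => ?_⟩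
    rcases le_total t T with htT | htT
    · refine le_max_of_le_left (norm_le_of_abs_natCoord_le hM fun j hj => ?_)
      exact hgrow τ _ (htraj τ d x hS hd hx) (fun i _ => (abs_natCoord_le _ _).trans h0) j hj t
        ⟨ht, htT⟩
    · refine le_max_of_le_right ((h τ d x hS hd hx h0 t htT).trans ?_)
      have : μ * Real.exp (-(2 / 5 * (t - T))) ≤ μ :=
        mul_le_of_le_one_right hμ.le (Real.exp_le_one_iff.2 (by linarith))
      gcongr
  · intro ε hε
    set ρ := min μ (ε / ((n + 1) * 2 ^ n)) with hρ
    have hρ0 : 0 < ρ := lt_min hμ (by positivity)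
    refine ⟨5 / 8 * (ρ / 4 ^ n) / 2 ^ n, by positivity, fun τ d x hS _ hd hx h0 t ht => ?_⟩
    have hX := htraj τ d x hS hd hx
    have h1 := hX.exponential_decay hG hρ0.le (min_le_left _ _) (N := 0) (t := t) (fun j hj => by
      rw [hS.1]
      refine (abs_pascal_le (f := natCoord (x 0)) j 0
        fun i _ => (abs_natCoord_le _ _).trans h0).trans ?_
      have e1 : (2 : ℝ) ^ j ≤ 2 ^ n := pow_le_pow_right₀ (by norm_num) hj
      have e2 : ρ / 4 ^ n ≤ ρ / 4 ^ j :=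
        div_le_div_of_nonneg_left hρ0.le (by positivity) (pow_le_pow_right₀ (by norm_num) hj)
      calc (2 : ℝ) ^ j * (5 / 8 * (ρ / 4 ^ n) / 2 ^ n)
          ≤ 2 ^ n * (5 / 8 * (ρ / 4 ^ n) / 2 ^ n) := by gcongr
        _ = 5 / 8 * (ρ / 4 ^ n) := by field_simp
        _ ≤ 5 / 8 * (ρ / 4 ^ j) := by gcongr) (by rw [hS.1]; exact ht)
    rw [hS.1, sub_zero] at h1
    refine (norm_le_of_abs_natCoord_le (by positivity) h1).trans ?_
    have e3 : ρ * Real.exp (-(2 / 5 * t)) ≤ ε / ((n + 1) * 2 ^ n) :=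
      (mul_le_of_le_one_right hρ0.le (Real.exp_le_one_iff.2 (by linarith))).trans (min_le_right _ _)
    calc (n + 1) * (2 ^ n * (ρ * Real.exp (-(2 / 5 * t))))
        ≤ (n + 1) * (2 ^ n * (ε / ((n + 1) * 2 ^ n))) := by gcongr
      _ = ε := by field_simp
  · intro ε R0 hε _
    obtain ⟨T, hT, h⟩ := hlate R0
    have hlim : Tendsto (fun t => (n + 1) * (2 ^ n * (μ * Real.exp (-(2 / 5 * (t - T))))))
        atTop (nhds ((n + 1) * (2 ^ n * (μ * 0)))) := by
      refine ((Tendsto.const_mul μ ?_).const_mul _).const_mul _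
      refine Real.tendsto_exp_neg_atTop_nhds_zero.comp ?_
      exact (tendsto_atTop_add_const_right _ (-T) tendsto_id).const_mul_atTop (by norm_num)
    rw [mul_zero, mul_zero, mul_zero] at hlim
    obtain ⟨T', hT'⟩ := eventually_atTop.1 (hlim.eventually (gt_mem_nhds hε))
    exact ⟨max T T', hT.trans (le_max_left _ _), fun τ d x hS _ hd hx h0 t ht =>
      (h τ d x hS hd hx h0 t ((le_max_left _ _).trans ht)).trans
        (hT' t ((le_max_right _ _).trans ht)).le⟩
end
end
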